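/- arXiv:2305.15691 — 14 statements merged into one kernel-verified Lean document; each statement's English description precedes it below -/
import Mathlib

section
/- Let F be a finite collection of pairwise disjoint nonempty open subsets of ℝ^D and let T ≥ 1. Let q : F^T → ℝ be a nonnegative function with Σ_{(f₁,…,f_T) ∈ F^T} q(f₁,…,f_T) = 1. (a) If all T one-dimensional marginals of q coincide, i.e. for every f ∈ F and all i, j ∈ {1,…,T}, Σ over tuples with i-th entry f of q equals Σ over tuples with j-th entry f of q, then there exists a probability measure μ on (ℝ^D)^T, absolutely continuous with respect to Lebesgue measure, whose T ℝ^D-valued coordinate marginals are all equal (stationarity), and such that μ(f₁ × ⋯ × f_T) = q(f₁,…,f_T) for every tuple (f₁,…,f_T) ∈ F^T. (b) If q is invariant under every permutation of its T arguments, then μ can in addition be taken invariant under every permutation of its T ℝ^D-valued coordinate blocks (exchangeability). -/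
open MeasureTheory
open scoped Classical

lemma map_comp_perm_pi {ι E : Type*} [Fintype ι] [MeasurableSpace E] {μ : ι → Measure E}
    [∀ i, SigmaFinite (μ i)] (π : Equiv.Perm ι) :
    (Measure.pi μ).map (fun ζ => ζ ∘ π) = Measure.pi (fun t => μ (π t)) := by
  have hmeas : Measurable fun ζ : ι → E => ζ ∘ π :=
    measurable_pi_lambda _ fun t => measurable_pi_apply (π t)
  refine (Measure.pi_eq fun s hs => ?_).symm
  have hpre : (fun ζ : ι → E => ζ ∘ π) ⁻¹' Set.univ.pi s =
      Set.univ.pi fun t => s (π.symm t) := by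
    ext ζ
    simp only [Set.mem_preimage, Set.mem_univ_pi, Function.comp_apply]
    exact ⟨fun h t => by simpa using h (π.symm t), fun h t => by simpa using h (π t)⟩
  rw [Measure.map_apply hmeas (MeasurableSet.univ_pi hs), hpre, Measure.pi_pi,
    ← Equiv.prod_comp π]
  simp

/-- The finite mixture of the product measures `⨂ t, ν (g t)`, with weight `w g` on each tuple
`g` of elements of `F`. -/
noncomputable def piMixture {ι κ E : Type*} [Fintype ι] [DecidableEq ι] [MeasurableSpace E]
    (F : Finset κ) (w : (ι → κ) → ENNReal) (ν : κ → Measure E) : Measure (ι → E) :=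
  ∑ g ∈ Fintype.piFinset (fun _ : ι => F), w g • Measure.pi (fun t => ν (g t))

section piMixture

variable {ι κ E : Type*} [Fintype ι] [DecidableEq ι] [MeasurableSpace E] {F : Finset κ}
  {w : (ι → κ) → ENNReal} {ν : κ → Measure E}

lemma piMixture_apply (s : Set (ι → E)) :
    piMixture F w ν s =
      ∑ g ∈ Fintype.piFinset (fun _ : ι => F), w g * Measure.pi (fun t => ν (g t)) s := by
  simp [piMixture]

lemma isProbabilityMeasure_piMixture [∀ k, IsProbabilityMeasure (ν k)]
    (hw : ∑ g ∈ Fintype.piFinset (fun _ : ι => F), w g = 1) :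
    IsProbabilityMeasure (piMixture F w ν) :=
  ⟨by simpa [piMixture_apply] using hw⟩

lemma piMixture_absolutelyContinuous {ρ : Measure (ι → E)}
    (h : ∀ g : ι → κ, (∀ t, g t ∈ F) → Measure.pi (fun t => ν (g t)) ≪ ρ) :
    piMixture F w ν ≪ ρ := by
  intro s hs
  rw [piMixture_apply]
  refine Finset.sum_eq_zero fun g hg => ?_
  rw [h g (Fintype.mem_piFinset.1 hg) hs, mul_zero]

/-- If `ν k` is concentrated on `A k`, then the mixture gives the box `∏ t, A (f t)` the weight
of `f`. -/
lemma piMixture_univ_pi [∀ k, SigmaFinite (ν k)] {A : κ → Set E}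
    (hself : ∀ k ∈ F, ν k (A k) = 1) (hne : ∀ k ∈ F, ∀ l ∈ F, k ≠ l → ν k (A l) = 0)
    {f : ι → κ} (hf : ∀ t, f t ∈ F) :
    piMixture F w ν (Set.univ.pi fun t => A (f t)) = w f := by
  rw [piMixture_apply, Finset.sum_eq_single f]
  · simp [Measure.pi_pi, hself _ (hf _)]
  · intro g hg hgf
    obtain ⟨t, ht⟩ := Function.ne_iff.1 hgf
    rw [Measure.pi_pi, Finset.prod_eq_zero (Finset.mem_univ t), mul_zero]
    exact hne _ (Fintype.mem_piFinset.1 hg t) _ (hf t) ht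
  · exact fun h => absurd (Fintype.mem_piFinset.2 hf) h

lemma map_eval_piMixture [DecidableEq κ] [∀ k, IsProbabilityMeasure (ν k)] (i : ι) :
    (piMixture F w ν).map (fun ζ => ζ i) =
      ∑ k ∈ F, (∑ g ∈ Fintype.piFinset (fun _ : ι => F), if g i = k then w g else 0) • ν k := by
  have hmap (g : ι → κ) :
      (Measure.pi fun t => ν (g t)).map (fun ζ => ζ i) = ν (g i) :=
    (measurePreserving_eval (fun t => ν (g t)) i).map_eq
  rw [piMixture, Measure.map_finset_sum (measurable_pi_apply i).aemeasurable]
  simp_rw [Measure.map_smul, hmap, Finset.sum_smul]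
  rw [Finset.sum_comm]
  refine Finset.sum_congr rfl fun g hg => ?_
  simp [ite_smul, Fintype.mem_piFinset.1 hg i]

lemma map_comp_perm_piMixture [∀ k, SigmaFinite (ν k)] (π : Equiv.Perm ι)
    (hw : ∀ g : ι → κ, (∀ t, g t ∈ F) → w (g ∘ π) = w g) :
    (piMixture F w ν).map (fun ζ => ζ ∘ π) = piMixture F w ν := by
  have hmeas : Measurable fun ζ : ι → E => ζ ∘ π :=
    measurable_pi_lambda _ fun t => measurable_pi_apply (π t)
  rw [piMixture, Measure.map_finset_sum hmeas.aemeasurable]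
  simp_rw [Measure.map_smul, map_comp_perm_pi]
  refine Finset.sum_equiv (π.symm.arrowCongr (Equiv.refl κ)) (fun g => ?_) fun g hg => ?_
  · simp only [Fintype.mem_piFinset]
    exact (π.forall_congr_right (q := fun t => g t ∈ F)).symm
  · rw [← hw g (Fintype.mem_piFinset.1 hg)]
    rfl

end piMixture

lemma map_eval_eq_of_map_comp_perm_eq {ι E : Type*} [MeasurableSpace E]
    {μ : Measure (ι → E)} (h : ∀ π : Equiv.Perm ι, μ.map (fun ζ => ζ ∘ π) = μ) (i j : ι) :
    μ.map (fun ζ => ζ i) = μ.map (fun ζ => ζ j) := by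
  have hmeas : Measurable fun ζ : ι → E => ζ ∘ Equiv.swap i j :=
    measurable_pi_lambda _ fun t => measurable_pi_apply (Equiv.swap i j t)
  conv_lhs => rw [← h (Equiv.swap i j), Measure.map_map (measurable_pi_apply i) hmeas]
  congr 1
  ext ζ
  simp

lemma pi_cond_absolutelyContinuous {ι : Type*} [Fintype ι] {E : ι → Type*}
    [∀ i, MeasurableSpace (E i)] (μ : ∀ i, Measure (E i)) [∀ i, SigmaFinite (μ i)]
    (B : ∀ i, Set (E i)) :
    Measure.pi (fun i => ProbabilityTheory.cond (μ i) (B i)) ≪ Measure.pi μ := by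
  have h : Measure.pi (fun i => ProbabilityTheory.cond (μ i) (B i)) =
      (∏ i, (μ i (B i))⁻¹) • (Measure.pi μ).restrict (Set.univ.pi B) := by
    rw [Measure.restrict_pi_pi]
    refine Measure.pi_eq fun s _ => ?_
    simp [ProbabilityTheory.cond, Measure.pi_pi, Finset.prod_mul_distrib]
  rw [h]
  exact Measure.smul_absolutelyContinuous.trans Measure.restrict_le_self.absolutelyContinuous

/-- Every nonempty open set carries a normalized restriction of the ambient measure. -/
lemma exists_cond_concentrated {E : Type*} [PseudoMetricSpace E] [ProperSpace E]
    [MeasurableSpace E] [OpensMeasurableSpace E] (μ : Measure E) [μ.IsOpenPosMeasure]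
    [IsFiniteMeasureOnCompacts μ] {U : Set E} (hU : IsOpen U) (hne : U.Nonempty) :
    ∃ B : Set E, IsProbabilityMeasure (ProbabilityTheory.cond μ B) ∧
      ProbabilityTheory.cond μ B U = 1 := by
  obtain ⟨x, hx⟩ := hne
  obtain ⟨r, hr, hrU⟩ := Metric.isOpen_iff.1 hU x hx
  have hpos : μ (Metric.ball x r) ≠ 0 := (Metric.measure_ball_pos μ x hr).ne'
  have hfin : μ (Metric.ball x r) ≠ ⊤ := measure_ball_lt_top.ne
  have hprob := ProbabilityTheory.cond_isProbabilityMeasure_of_finite hpos hfin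
  exact ⟨Metric.ball x r, hprob,
    le_antisymm prob_le_one
      ((ProbabilityTheory.cond_apply_self hpos hfin).symm.le.trans (measure_mono hrU))⟩

/-- Proposition 1: discretization loses no information. Part (a): if the discrete
distribution `q` on the regions built from the patches in `F` has equal one-dimensional
marginals, it can be rationalized by an absolutely continuous stationary probability
measure on `(ℝ^D)^T`; part (b): if `q` is exchangeable, the measure can in addition be
taken exchangeable. -/
theorem stmt0 (D T : ℕ) (hD : 1 ≤ D) (hT : 1 ≤ T)
    (F : Finset (Set (Fin D → ℝ)))
    (hopen : ∀ f ∈ F, IsOpen f)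
    (hne : ∀ f ∈ F, f.Nonempty)
    (hdisj : ∀ f ∈ F, ∀ g ∈ F, f ≠ g → Disjoint f g)
    (q : (Fin T → Set (Fin D → ℝ)) → ℝ)
    (hq0 : ∀ f : Fin T → Set (Fin D → ℝ), (∀ t, f t ∈ F) → 0 ≤ q f)
    (hq1 : ∑ f ∈ Fintype.piFinset (fun _ : Fin T => F), q f = 1) :
    ((∀ f ∈ F, ∀ i j : Fin T,
        (∑ g ∈ Fintype.piFinset (fun _ : Fin T => F), if g i = f then q g else 0)
          = ∑ g ∈ Fintype.piFinset (fun _ : Fin T => F), if g j = f then q g else 0) →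
      ∃ μ : Measure (Fin T → Fin D → ℝ), IsProbabilityMeasure μ ∧
        μ ≪ volume ∧
        (∀ i j : Fin T, μ.map (fun ζ => ζ i) = μ.map (fun ζ => ζ j)) ∧
        (∀ f : Fin T → Set (Fin D → ℝ), (∀ t, f t ∈ F) →
          μ (Set.univ.pi f) = ENNReal.ofReal (q f))) ∧
    ((∀ f : Fin T → Set (Fin D → ℝ), (∀ t, f t ∈ F) → ∀ π : Equiv.Perm (Fin T),
        q (f ∘ π) = q f) →
      ∃ μ : Measure (Fin T → Fin D → ℝ), IsProbabilityMeasure μ ∧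
        μ ≪ volume ∧
        (∀ i j : Fin T, μ.map (fun ζ => ζ i) = μ.map (fun ζ => ζ j)) ∧
        (∀ π : Equiv.Perm (Fin T), μ.map (fun ζ => ζ ∘ π) = μ) ∧
        (∀ f : Fin T → Set (Fin D → ℝ), (∀ t, f t ∈ F) →
          μ (Set.univ.pi f) = ENNReal.ofReal (q f))) := by
  have hB : ∀ f : Set (Fin D → ℝ), ∃ B : Set (Fin D → ℝ),
      IsProbabilityMeasure (ProbabilityTheory.cond volume B) ∧
      (f ∈ F → ProbabilityTheory.cond volume B f = 1) := by
    intro f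
    by_cases hf : f ∈ F
    · obtain ⟨B, h1, h2⟩ := exists_cond_concentrated volume (hopen f hf) (hne f hf)
      exact ⟨B, h1, fun _ => h2⟩
    · obtain ⟨B, h1, -⟩ := exists_cond_concentrated (volume : Measure (Fin D → ℝ))
        isOpen_univ Set.univ_nonempty
      exact ⟨B, h1, fun h => absurd h hf⟩
  choose B hprob hself using hB
  have hother : ∀ f ∈ F, ∀ g ∈ F, f ≠ g → ProbabilityTheory.cond volume (B f) g = 0 := by
    intro f hf g hg hfg
    refine measure_mono_null (hdisj f hf g hg hfg).subset_compl_left ?_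
    exact (prob_compl_eq_zero_iff (hopen f hf).measurableSet).2 (hself f hf)
  set ν : Set (Fin D → ℝ) → Measure (Fin D → ℝ) := fun f => ProbabilityTheory.cond volume (B f)
  set w : (Fin T → Set (Fin D → ℝ)) → ENNReal := fun f => ENNReal.ofReal (q f)
  have hw1 : ∑ g ∈ Fintype.piFinset (fun _ : Fin T => F), w g = 1 := by
    rw [← ENNReal.ofReal_sum_of_nonneg fun g hg => hq0 g (Fintype.mem_piFinset.1 hg), hq1,
      ENNReal.ofReal_one]
  have hμprob : IsProbabilityMeasure (piMixture F w ν) := isProbabilityMeasure_piMixture hw1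
  have hac : piMixture F w ν ≪ volume :=
    piMixture_absolutelyContinuous fun g _ =>
      pi_cond_absolutelyContinuous (fun _ => volume) fun t => B (g t)
  have hbox : ∀ f : Fin T → Set (Fin D → ℝ), (∀ t, f t ∈ F) →
      piMixture F w ν (Set.univ.pi f) = ENNReal.ofReal (q f) := fun f hf =>
    piMixture_univ_pi (A := id) hself hother hf
  refine ⟨fun hmarg => ⟨piMixture F w ν, hμprob, hac, fun i j => ?_, hbox⟩, fun hexch => ?_⟩
  · have hsum : ∀ (f : Set (Fin D → ℝ)) (i : Fin T),
        (∑ g ∈ Fintype.piFinset (fun _ : Fin T => F), if g i = f then w g else 0) =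
          ENNReal.ofReal
            (∑ g ∈ Fintype.piFinset (fun _ : Fin T => F), if g i = f then q g else 0) := by
      intro f i
      rw [ENNReal.ofReal_sum_of_nonneg]
      · refine Finset.sum_congr rfl fun g _ => ?_
        split_ifs <;> simp [w]
      · intro g hg
        split_ifs
        exacts [hq0 g (Fintype.mem_piFinset.1 hg), le_rfl]
    rw [map_eval_piMixture, map_eval_piMixture]
    refine Finset.sum_congr rfl fun f hf => ?_
    rw [hsum, hsum, hmarg f hf i j]
  · have hperm : ∀ π : Equiv.Perm (Fin T),
        (piMixture F w ν).map (fun ζ => ζ ∘ π) = piMixture F w ν := fun π =>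
      map_comp_perm_piMixture π fun g hg => congrArg ENNReal.ofReal (hexch g hg π)
    exact ⟨piMixture F w ν, hμprob, hac, map_eval_eq_of_map_comp_perm_eq hperm, hperm, hbox⟩
end

section
/- Let A ∈ ℝ^{m×n} and R ∈ ℝ^{k×n} be matrices and let C = {A q : q ∈ ℝⁿ, q ≥ 0 componentwise, R q = 0} ⊆ ℝ^m. Then the dual cone of C, namely C* = {y ∈ ℝ^m : yᵀ p ≤ 0 for all p ∈ C}, equals {y ∈ ℝ^m : there exists z ∈ ℝ^k with Aᵀ y ≤ Rᵀ z componentwise}. -/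
/-- Finitely many lower and upper bounds on `t`, given as `c i ≤ a i * t` with the sign of `a i`
arbitrary, are satisfiable as soon as they are pairwise compatible. -/
lemma exists_forall_le_mul {ι : Type} [Fintype ι] (a c : ι → ℝ)
    (hzero : ∀ i, a i = 0 → c i ≤ 0)
    (hpair : ∀ i j, 0 < a i → a j < 0 → -a j * c i + a i * c j ≤ 0) :
    ∃ t, ∀ i, c i ≤ a i * t := by
  classical
  have hquot : ∀ i j, 0 < a i → a j < 0 → c i / a i ≤ c j / a j := by
    intro i j hi hj
    rw [div_le_iff₀ hi, div_mul_eq_mul_div, le_div_iff_of_neg hj]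
    linarith [hpair i j hi hj]
  suffices ∃ t, (∀ i, 0 < a i → c i / a i ≤ t) ∧ ∀ j, a j < 0 → t ≤ c j / a j by
    obtain ⟨t, hlower, hupper⟩ := this
    refine ⟨t, fun i => ?_⟩
    rcases lt_trichotomy (a i) 0 with h | h | h
    · have := (le_div_iff_of_neg h).1 (hupper i h)
      linarith
    · simpa [h] using hzero i h
    · have := (div_le_iff₀ h).1 (hlower i h)
      linarith
  by_cases hP : (Finset.univ.filter fun i => 0 < a i).Nonempty
  · obtain ⟨i, hi, hmax⟩ := Finset.exists_max_image _ (fun i => c i / a i) hP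
    simp only [Finset.mem_filter, Finset.mem_univ, true_and] at hi hmax
    exact ⟨c i / a i, hmax, fun j hj => hquot i j hi hj⟩
  have hP' : ∀ i, ¬ 0 < a i := fun i hi => hP ⟨i, by simpa using hi⟩
  by_cases hN : (Finset.univ.filter fun i => a i < 0).Nonempty
  · obtain ⟨j, -, hmin⟩ := Finset.exists_min_image _ (fun i => c i / a i) hN
    simp only [Finset.mem_filter, Finset.mem_univ, true_and] at hmin
    exact ⟨c j / a j, fun i hi => absurd hi (hP' i), hmin⟩
  · exact ⟨0, fun i hi => absurd hi (hP' i), fun j hj => absurd ⟨j, by simpa using hj⟩ hN⟩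

lemma sum_pair_weights_mul {ι : Type} [Fintype ι] (α β w : ι × ι → ℝ) (f : ι → ℝ) :
    ∑ l, (∑ j, w (l, j) * α (l, j) + ∑ i, w (i, l) * β (i, l)) * f l
      = ∑ p, w p * (α p * f p.1 + β p * f p.2) := by
  simp only [add_mul, mul_add, Finset.sum_add_distrib, Finset.sum_mul, Fintype.sum_prod_type,
    mul_assoc]
  congr 1
  exact Finset.sum_comm

/-- **Farkas' lemma** for a finite system of linear inequalities `b i ≤ ∑ l, r i l * z l`,
by Fourier–Motzkin elimination. -/
theorem exists_forall_le_sum_mul (k : ℕ) {ι : Type} [Fintype ι] (r : ι → Fin k → ℝ) (b : ι → ℝ)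
    (h : ∀ q : ι → ℝ, (∀ i, 0 ≤ q i) → (∀ l, ∑ i, q i * r i l = 0) → ∑ i, q i * b i ≤ 0) :
    ∃ z : Fin k → ℝ, ∀ i, b i ≤ ∑ l, r i l * z l := by
  classical
  induction k generalizing ι with
  | zero =>
    refine ⟨0, fun i => ?_⟩
    have := h (Pi.single i 1) (fun j => by by_cases hj : j = i <;> simp [hj])
      (fun l => l.elim0)
    simpa [Pi.single_apply] using this
  | succ k ih =>
    let α : ι × ι → ℝ := fun p =>
      if r p.1 0 = 0 then 1 else if 0 < r p.1 0 ∧ r p.2 0 < 0 then -r p.2 0 else 0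
    let β : ι × ι → ℝ := fun p => if 0 < r p.1 0 ∧ r p.2 0 < 0 then r p.1 0 else 0
    have hα : ∀ p, 0 ≤ α p := by
      intro p; dsimp only [α]; split_ifs with h1 h2 <;> linarith
    have hβ : ∀ p, 0 ≤ β p := by
      intro p; dsimp only [β]; split_ifs with h1 <;> linarith
    have hcancel : ∀ p, α p * r p.1 0 + β p * r p.2 0 = 0 := by
      intro p; dsimp only [α, β]; split_ifs with h1 h2 <;> first | (simp [h1]; done) | grind
    obtain ⟨z, hz⟩ := ih (fun p l => α p * r p.1 (Fin.succ l) + β p * r p.2 (Fin.succ l))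
      (fun p => α p * b p.1 + β p * b p.2) (by
        intro w hw hw0
        rw [← sum_pair_weights_mul α β w b]
        refine h _ (fun l => add_nonneg
          (Finset.sum_nonneg fun j _ => mul_nonneg (hw _) (hα _))
          (Finset.sum_nonneg fun i _ => mul_nonneg (hw _) (hβ _))) fun l => ?_
        rw [sum_pair_weights_mul α β w fun i => r i l]
        refine Fin.cases ?_ (fun l => hw0 l) l
        exact Finset.sum_eq_zero fun p _ => by rw [hcancel, mul_zero])
    have hres : ∀ p : ι × ι, α p * (b p.1 - ∑ l : Fin k, r p.1 l.succ * z l)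
        + β p * (b p.2 - ∑ l : Fin k, r p.2 l.succ * z l) ≤ 0 := by
      intro p
      have := hz p
      simp only [add_mul, Finset.sum_add_distrib, mul_assoc, ← Finset.mul_sum] at this
      linarith
    obtain ⟨t, ht⟩ := exists_forall_le_mul (fun i => r i 0)
      (fun i => b i - ∑ l : Fin k, r i l.succ * z l)
      (fun i hi => by simpa [α, β, hi] using hres (i, i))
      (fun i j hi hj => by simpa [α, β, hi, hj, hi.ne'] using hres (i, j))
    refine ⟨Fin.cons t z, fun i => ?_⟩
    rw [Fin.sum_univ_succ]
    simp only [Fin.cons_zero, Fin.cons_succ]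
    linarith [ht i]


/-- The dual cone of the discrete choice cone `C = {A q : q ≥ 0, R q = 0}` equals
`{y : ∃ z, Aᵀ y ≤ Rᵀ z}`. -/
theorem stmt1 (m n k : ℕ) (A : Matrix (Fin m) (Fin n) ℝ) (R : Matrix (Fin k) (Fin n) ℝ) :
    {y : Fin m → ℝ | ∀ p ∈ {p : Fin m → ℝ | ∃ q : Fin n → ℝ,
        (∀ i, 0 ≤ q i) ∧ R.mulVec q = 0 ∧ p = A.mulVec q},
      ∑ i, y i * p i ≤ 0}
    = {y : Fin m → ℝ | ∃ z : Fin k → ℝ,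
        ∀ j, A.transpose.mulVec y j ≤ R.transpose.mulVec z j} := by
  have hadj : ∀ (y : Fin m → ℝ) (q : Fin n → ℝ),
      ∑ i, y i * A.mulVec q i = ∑ j, q j * A.transpose.mulVec y j := fun y q => by
    change y ⬝ᵥ A.mulVec q = q ⬝ᵥ A.transpose.mulVec y
    rw [Matrix.dotProduct_mulVec, Matrix.mulVec_transpose, dotProduct_comm]
  ext y
  simp only [Set.mem_ofPred_eq]
  constructor
  · intro h
    refine exists_forall_le_sum_mul k (fun j l => R l j) (A.transpose.mulVec y) fun q hq hR => ?_
    rw [← hadj]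
    refine h _ ⟨q, hq, funext fun l => ?_, rfl⟩
    simpa [Matrix.mulVec, dotProduct, mul_comm] using hR l
  · rintro ⟨z, hz⟩ p ⟨q, hq, hR, rfl⟩
    rw [hadj]
    calc ∑ j, q j * A.transpose.mulVec y j
        ≤ q ⬝ᵥ R.transpose.mulVec z :=
          Finset.sum_le_sum fun j _ => mul_le_mul_of_nonneg_left (hz j) (hq j)
      _ = 0 := by
          rw [Matrix.dotProduct_mulVec, Matrix.vecMul_transpose, hR, zero_dotProduct]
end

section
/- Let A ∈ ℝ^{m×n} and R ∈ ℝ^{k×n}, let C = {A q : q ∈ ℝⁿ, q ≥ 0, R q = 0} ⊆ ℝ^m, and let Q₀ = {y ∈ ℝ^m : ∃ z ∈ ℝ^k with Aᵀ y ≤ Rᵀ z componentwise, and ‖y‖_∞ ≤ 1}. Then for every p ∈ ℝ^m, p ∈ C if and only if yᵀ p ≤ 0 for every extreme point y of Q₀. In particular, if y₁,…,y_M are the (finitely many) extreme points of the polytope Q₀, then C = {p ∈ ℝ^m : y_iᵀ p ≤ 0 for all i = 1,…,M}. -/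
section FinitelyGeneratedCone

variable {ι E : Type*} [Fintype ι] [AddCommGroup E] [Module ℝ E]

/-- The elimination step of the conic Carathéodory theorem: a nonnegative combination supported on
linearly dependent generators can be rewritten without one of them. -/
theorem exists_nonneg_supported_erase [DecidableEq ι] (f : (ι → ℝ) →ₗ[ℝ] E) {s : Finset ι}
    {g : ι → ℝ} (hg : ∀ i ∉ s, g i = 0) (hfg : f g = 0) (hpos : ∃ i, 0 < g i)
    {c : ι → ℝ} (hc : 0 ≤ c) (hcs : ∀ i ∉ s, c i = 0) :
    ∃ i ∈ s, ∃ d : ι → ℝ, 0 ≤ d ∧ (∀ j ∉ s.erase i, d j = 0) ∧ f d = f c := by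
  obtain ⟨i, hi, hmin⟩ := (Finset.univ.filter fun i => 0 < g i).exists_min_image
    (fun i => c i / g i) (by obtain ⟨i, hi⟩ := hpos; exact ⟨i, by simpa using hi⟩)
  have hgi : 0 < g i := by simpa using hi
  have his : i ∈ s := by
    by_contra h
    exact hgi.ne' (hg i h)
  refine ⟨i, his, c - (c i / g i) • g, fun j => ?_, fun j hj => ?_, by simp [hfg]⟩
  · simp only [Pi.zero_apply, Pi.sub_apply, Pi.smul_apply, smul_eq_mul, sub_nonneg]
    rcases lt_or_ge 0 (g j) with hgj | hgj
    · exact (le_div_iff₀ hgj).1 (hmin j (by simpa using hgj))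
    · exact (mul_nonpos_of_nonneg_of_nonpos (div_nonneg (hc i) hgi.le) hgj).trans (hc j)
  · by_cases hji : j = i
    · subst hji
      simp [hgi.ne']
    · have hjs : j ∉ s := fun h => hj (Finset.mem_erase.2 ⟨hji, h⟩)
      simp [hg j hjs, hcs j hjs]

variable [TopologicalSpace E] [IsTopologicalAddGroup E] [ContinuousSMul ℝ E] [T2Space E]

/-- The cone generated by the images of the basis vectors indexed by a finset is closed. -/
theorem isClosed_image_nonneg_supported (f : (ι → ℝ) →ₗ[ℝ] E) (s : Finset ι) :
    IsClosed (f '' {c | 0 ≤ c ∧ ∀ i ∉ s, c i = 0}) := by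
  classical
  induction s using Finset.strongInduction with
  | H s ih =>
    by_cases hdep : ∃ g : ι → ℝ, (∀ i ∉ s, g i = 0) ∧ f g = 0 ∧ ∃ i, 0 < g i
    · obtain ⟨g, hg, hfg, hpos⟩ := hdep
      have hunion : f '' {c | 0 ≤ c ∧ ∀ i ∉ s, c i = 0} =
          ⋃ i ∈ s, f '' {c | 0 ≤ c ∧ ∀ j ∉ s.erase i, c j = 0} := by
        ext x
        simp only [Set.mem_iUnion, Set.mem_image, Set.mem_ofPred_eq, exists_prop]
        constructor
        · rintro ⟨c, ⟨hc, hcs⟩, rfl⟩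
          obtain ⟨i, hi, d, hd, hds, hfd⟩ :=
            exists_nonneg_supported_erase f hg hfg hpos hc hcs
          exact ⟨i, hi, d, ⟨hd, hds⟩, hfd⟩
        · rintro ⟨i, _, d, ⟨hd, hds⟩, hfd⟩
          exact ⟨d, ⟨hd, fun j hj => hds j fun h => hj (Finset.mem_of_mem_erase h)⟩, hfd⟩
      rw [hunion]
      exact s.finite_toSet.isClosed_biUnion fun i hi => ih _ (Finset.erase_ssubset hi)
    · push Not at hdep
      let V : Submodule ℝ (ι → ℝ) :=
        { carrier := {c | ∀ i ∉ s, c i = 0}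
          add_mem' := fun ha hb i hi => by simp [ha i hi, hb i hi]
          zero_mem' := fun i _ => rfl
          smul_mem' := fun r a ha i hi => by simp [ha i hi] }
      have hinj : LinearMap.ker (f.domRestrict V) = ⊥ := by
        rw [LinearMap.ker_eq_bot']
        rintro ⟨g, hg⟩ hfg
        have hfg : f g = 0 := hfg
        ext i
        refine le_antisymm (hdep g hg hfg i) ?_
        have := hdep (-g) (fun j hj => by simp [hg j hj]) (by simp [hfg]) i
        simpa using this
      have hclosed : IsClosed {c : V | (0 : ι → ℝ) ≤ c} :=
        isClosed_le continuous_const continuous_subtype_val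
      convert (LinearMap.isClosedEmbedding_of_injective hinj).isClosedMap _ hclosed using 1
      ext x
      constructor
      · rintro ⟨c, ⟨hc, hcs⟩, rfl⟩
        exact ⟨⟨c, hcs⟩, hc, rfl⟩
      · rintro ⟨⟨c, hcs⟩, hc, rfl⟩
        exact ⟨c, ⟨hc, hcs⟩, rfl⟩

/-- A finitely generated cone is closed. -/
theorem isClosed_image_nonneg (f : (ι → ℝ) →ₗ[ℝ] E) : IsClosed (f '' {c | 0 ≤ c}) := by
  simpa using isClosed_image_nonneg_supported f Finset.univ

/-- **Farkas' lemma** for a finitely generated cone. -/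
theorem exists_strongDual_neg_of_notMem_image_nonneg [LocallyConvexSpace ℝ E]
    (f : (ι → ℝ) →ₗ[ℝ] E) {x : E} (hx : x ∉ f '' {c | 0 ≤ c}) :
    ∃ φ : StrongDual ℝ E, (∀ c, 0 ≤ c → 0 ≤ φ (f c)) ∧ φ x < 0 := by
  let K : ProperCone ℝ E :=
    { carrier := f '' {c | 0 ≤ c}
      add_mem' := by
        rintro _ _ ⟨a, ha, rfl⟩ ⟨b, hb, rfl⟩
        exact ⟨a + b, show 0 ≤ a + b from add_nonneg ha hb, map_add f a b⟩
      zero_mem' := ⟨0, show (0 : ι → ℝ) ≤ 0 from le_rfl, map_zero f⟩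
      smul_mem' := by
        rintro r _ ⟨a, ha, rfl⟩
        exact ⟨(r : ℝ) • a, show 0 ≤ (r : ℝ) • a from smul_nonneg r.2 ha, map_smul f (r : ℝ) a⟩
      isClosed' := isClosed_image_nonneg f }
  obtain ⟨φ, hφ, hφx⟩ := K.hyperplane_separation_point (x₀ := x) hx
  exact ⟨φ, fun c hc => hφ _ ⟨c, hc, rfl⟩, hφx⟩

end FinitelyGeneratedCone

section DiscreteChoice

open Matrix

variable {m n k : Type*} [Fintype m] [Fintype k]

/-- The dual discrete choice polytope is convex. -/
theorem convex_dualChoicePolytope (A : Matrix m n ℝ) (R : Matrix k n ℝ) :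
    Convex ℝ {y : m → ℝ | (∃ z, Aᵀ *ᵥ y ≤ Rᵀ *ᵥ z) ∧ ∀ i, |y i| ≤ 1} := by
  rintro y ⟨⟨z, hz⟩, hy⟩ y' ⟨⟨z', hz'⟩, hy'⟩ a b ha hb hab
  refine ⟨⟨a • z + b • z', ?_⟩, fun i => ?_⟩
  · simp only [mulVec_add, mulVec_smul]
    exact add_le_add (smul_le_smul_of_nonneg_left hz ha) (smul_le_smul_of_nonneg_left hz' hb)
  · have h := abs_le.1 (hy i)
    have h' := abs_le.1 (hy' i)
    simp only [Pi.add_apply, Pi.smul_apply, smul_eq_mul, abs_le]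
    constructor <;> nlinarith

variable [Fintype n]

/-- The vectors dominated by some element of the range of a matrix form a closed set. -/
theorem isClosed_setOf_exists_le_mulVec (B : Matrix n k ℝ) :
    IsClosed {x : n → ℝ | ∃ z, x ≤ B *ᵥ z} := by
  let f : (k ⊕ k ⊕ n → ℝ) →ₗ[ℝ] (n → ℝ) :=
    B.mulVecLin ∘ₗ (LinearMap.funLeft ℝ ℝ Sum.inl - LinearMap.funLeft ℝ ℝ (Sum.inr ∘ Sum.inl)) -
      LinearMap.funLeft ℝ ℝ (Sum.inr ∘ Sum.inr)
  have hf (c) : f c = B *ᵥ (c ∘ Sum.inl - c ∘ Sum.inr ∘ Sum.inl) - c ∘ Sum.inr ∘ Sum.inr := rfl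
  convert isClosed_image_nonneg f using 1
  ext x
  constructor
  · rintro ⟨z, hz⟩
    refine ⟨Sum.elim z⁺ (Sum.elim z⁻ (B *ᵥ z - x)), ?_, ?_⟩
    · rintro (i | i | i)
      · exact posPart_nonneg z i
      · exact negPart_nonneg z i
      · exact sub_nonneg.2 (hz i)
    · rw [hf]
      change B *ᵥ (z⁺ - z⁻) - (B *ᵥ z - x) = x
      rw [posPart_sub_negPart, sub_sub_cancel]
  · rintro ⟨c, hc, rfl⟩
    exact ⟨_, by rw [hf]; exact sub_le_self _ fun i => hc _⟩

/-- Farkas' lemma for a system of homogeneous equations: a vector outside the discrete choice cone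
is separated from it by a dual vector. -/
theorem exists_dual_pos_of_notMem_choiceCone (A : Matrix m n ℝ) (R : Matrix k n ℝ) {p : m → ℝ}
    (hp : ¬ ∃ q : n → ℝ, 0 ≤ q ∧ R *ᵥ q = 0 ∧ p = A *ᵥ q) :
    ∃ y : m → ℝ, (∃ z : k → ℝ, Aᵀ *ᵥ y ≤ Rᵀ *ᵥ z) ∧ 0 < y ⬝ᵥ p := by
  classical
  let f : (n → ℝ) →ₗ[ℝ] (m → ℝ) × (k → ℝ) := A.mulVecLin.prod R.mulVecLin
  have hx : (p, (0 : k → ℝ)) ∉ f '' {c | 0 ≤ c} := by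
    rintro ⟨q, hq, hfq⟩
    exact hp ⟨q, hq, congrArg Prod.snd hfq, (congrArg Prod.fst hfq).symm⟩
  obtain ⟨φ, hφ, hφp⟩ := exists_strongDual_neg_of_notMem_image_nonneg f hx
  let y : m → ℝ := fun i => φ (fun j => if i = j then 1 else 0, 0)
  let z : k → ℝ := fun i => φ (0, fun j => if i = j then 1 else 0)
  have hrep (u : m → ℝ) (v : k → ℝ) : φ (u, v) = y ⬝ᵥ u + z ⬝ᵥ v := by
    have hu : φ (u, 0) = y ⬝ᵥ u := by
      have := LinearMap.pi_apply_eq_sum_univ (φ.toLinearMap ∘ₗ LinearMap.inl ℝ (m → ℝ) (k → ℝ)) u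
      simpa [dotProduct, y, mul_comm] using this
    have hv : φ (0, v) = z ⬝ᵥ v := by
      have := LinearMap.pi_apply_eq_sum_univ (φ.toLinearMap ∘ₗ LinearMap.inr ℝ (m → ℝ) (k → ℝ)) v
      simpa [dotProduct, z, mul_comm] using this
    rw [← hu, ← hv, ← map_add]
    simp
  refine ⟨-y, ⟨z, fun j => ?_⟩, ?_⟩
  · have h := hφ (Pi.single j 1) (Pi.single_nonneg.2 zero_le_one)
    change 0 ≤ φ (A *ᵥ Pi.single j 1, R *ᵥ Pi.single j 1) at h
    rw [hrep, mulVec_single_one, mulVec_single_one] at h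
    have hA : (Aᵀ *ᵥ (-y)) j = -(y ⬝ᵥ A.col j) := by
      rw [mulVec_neg, Pi.neg_apply, dotProduct_comm]; rfl
    have hR : (Rᵀ *ᵥ z) j = z ⬝ᵥ R.col j := by
      rw [dotProduct_comm]; rfl
    rw [hA, hR]
    linarith
  · rw [hrep] at hφp
    simpa using hφp

/-- Dual vectors are nonpositive on the discrete choice cone. -/
theorem dotProduct_mulVec_nonpos (A : Matrix m n ℝ) (R : Matrix k n ℝ) {y : m → ℝ} {z : k → ℝ}
    {q : n → ℝ} (hyz : Aᵀ *ᵥ y ≤ Rᵀ *ᵥ z) (hq : 0 ≤ q) (hR : R *ᵥ q = 0) :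
    y ⬝ᵥ A *ᵥ q ≤ 0 :=
  calc y ⬝ᵥ A *ᵥ q = (Aᵀ *ᵥ y) ⬝ᵥ q := by rw [mulVec_transpose, dotProduct_mulVec]
    _ ≤ (Rᵀ *ᵥ z) ⬝ᵥ q := dotProduct_le_dotProduct_of_nonneg_right hyz hq
    _ = 0 := by rw [mulVec_transpose, ← dotProduct_mulVec, hR, dotProduct_zero]

/-- The dual discrete choice polytope is compact. -/
theorem isCompact_dualChoicePolytope (A : Matrix m n ℝ) (R : Matrix k n ℝ) :
    IsCompact {y : m → ℝ | (∃ z, Aᵀ *ᵥ y ≤ Rᵀ *ᵥ z) ∧ ∀ i, |y i| ≤ 1} := by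
  have hcont : Continuous fun y : m → ℝ => Aᵀ *ᵥ y := Continuous.matrix_mulVec continuous_const
    continuous_id
  have hbox : IsCompact (Set.Icc (-1) 1 : Set (m → ℝ)) := isCompact_Icc
  convert hbox.inter_left ((isClosed_setOf_exists_le_mulVec Rᵀ).preimage hcont) using 1
  ext y
  simp [abs_le, Pi.le_def, forall_and]

/-- A linear inequality on the extreme points of a compact convex set holds on the whole set. -/
theorem dotProduct_nonpos_of_extremePoints {Q : Set (m → ℝ)} (hQ : IsCompact Q)
    (hconv : Convex ℝ Q) {p : m → ℝ} (hp : ∀ y ∈ Q.extremePoints ℝ, y ⬝ᵥ p ≤ 0) {y : m → ℝ}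
    (hy : y ∈ Q) : y ⬝ᵥ p ≤ 0 := by
  have hclosed : IsClosed {y : m → ℝ | y ⬝ᵥ p ≤ 0} :=
    isClosed_le (continuous_id.dotProduct continuous_const) continuous_const
  have hhalf : Convex ℝ {y : m → ℝ | y ⬝ᵥ p ≤ 0} :=
    convex_halfSpace_le ⟨fun a b => add_dotProduct a b p, fun r a => smul_dotProduct r a p⟩ 0
  rw [← closure_convexHull_extremePoints hQ hconv] at hy
  exact closure_minimal (convexHull_min hp hhalf) hclosed hy

end DiscreteChoice

/-- The discrete choice cone `C` is characterized by the extreme points of the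
dual discrete choice polytope `Q₀`. -/
theorem stmt2 (m n k : ℕ) (A : Matrix (Fin m) (Fin n) ℝ) (R : Matrix (Fin k) (Fin n) ℝ)
    (C : Set (Fin m → ℝ))
    (hC : C = {p | ∃ q : Fin n → ℝ, (∀ i, 0 ≤ q i) ∧ R.mulVec q = 0 ∧ p = A.mulVec q})
    (Q₀ : Set (Fin m → ℝ))
    (hQ₀ : Q₀ = {y | (∃ z : Fin k → ℝ, ∀ j, A.transpose.mulVec y j ≤ R.transpose.mulVec z j)
        ∧ ∀ i, |y i| ≤ 1}) :
    ∀ p : Fin m → ℝ, p ∈ C ↔ ∀ y ∈ Set.extremePoints ℝ Q₀, ∑ i, y i * p i ≤ 0 := by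
  subst hC hQ₀
  intro p
  constructor
  · rintro ⟨q, hq, hR, rfl⟩ y hy
    obtain ⟨⟨z, hz⟩, -⟩ := hy.1
    exact dotProduct_mulVec_nonpos A R hz hq hR
  · intro hp
    by_contra hpC
    obtain ⟨y, ⟨z, hz⟩, hyp⟩ := exists_dual_pos_of_notMem_choiceCone A R hpC
    have hr : 0 < (‖y‖ + 1)⁻¹ := by positivity
    have hmem : (‖y‖ + 1)⁻¹ • y ∈ {y : Fin m → ℝ |
        (∃ z, A.transpose.mulVec y ≤ R.transpose.mulVec z) ∧ ∀ i, |y i| ≤ 1} := by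
      refine ⟨⟨(‖y‖ + 1)⁻¹ • z, ?_⟩, fun i => ?_⟩
      · rw [Matrix.mulVec_smul, Matrix.mulVec_smul]
        exact smul_le_smul_of_nonneg_left hz hr.le
      · rw [Pi.smul_apply, smul_eq_mul, abs_mul, abs_of_pos hr, inv_mul_le_one₀ (by positivity)]
        have := norm_le_pi_norm y i
        rw [Real.norm_eq_abs] at this
        linarith
    have hle := dotProduct_nonpos_of_extremePoints (isCompact_dualChoicePolytope A R)
      (convex_dualChoicePolytope A R) hp hmem
    rw [smul_dotProduct, smul_eq_mul] at hle
    exact absurd hle (not_le.2 (mul_pos hr hyp))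
end

section
/- Let A ∈ ℝ^{m×n} and R ∈ ℝ^{k×n}, let C = {A q : q ∈ ℝⁿ, q ≥ 0, R q = 0}, and let Q₀ = {y ∈ ℝ^m : ∃ z ∈ ℝ^k with Aᵀ y ≤ Rᵀ z componentwise, and ‖y‖_∞ ≤ 1}. Assume C ⊆ ℝ₊^m (every element of C is componentwise nonnegative). Then C = {p ∈ ℝ^m : p ≥ 0 and yᵀ p ≤ 0 for every undominated extreme point y of Q₀}. -/
/-- The conic form of Carathéodory's theorem: every conic combination of finitely many vectors is a
conic combination of a linearly independent subfamily. -/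
theorem exists_linearIndepOn_conic_combination {ι E : Type*} [AddCommGroup E] [Module ℝ E]
    (v : ι → E) (s : Finset ι) (q : ι → ℝ) (hq : ∀ i ∈ s, 0 ≤ q i) :
    ∃ t : Finset ι, t ⊆ s ∧ LinearIndepOn ℝ v (t : Set ι) ∧
      ∃ r : ι → ℝ, (∀ i ∈ t, 0 ≤ r i) ∧ ∑ i ∈ t, r i • v i = ∑ i ∈ s, q i • v i := by
  classical
  induction s using Finset.strongInduction generalizing q with
  | H s ih =>
    by_cases hs : LinearIndepOn ℝ v (s : Set ι)
    · exact ⟨s, subset_rfl, hs, q, hq, rfl⟩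
    obtain ⟨g, hg0, j, hjs, hj⟩ : ∃ g : ι → ℝ, ∑ i ∈ s, g i • v i = 0 ∧ ∃ j ∈ s, 0 < g j := by
      rw [linearIndepOn_finset_iff] at hs
      push Not at hs
      obtain ⟨g, hg0, j, hjs, hj⟩ := hs
      rcases lt_or_gt_of_ne hj with h | h
      · exact ⟨fun i ↦ -g i, by simp [neg_smul, hg0], j, hjs, by simpa using h⟩
      · exact ⟨g, hg0, j, hjs, h⟩
    obtain ⟨l, hl, hmin⟩ := (s.filter fun i ↦ 0 < g i).exists_min_image (fun i ↦ q i / g i)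
      ⟨j, Finset.mem_filter.2 ⟨hjs, hj⟩⟩
    obtain ⟨hls, hgl⟩ := Finset.mem_filter.1 hl
    set c := q l / g l with hc
    have hc0 : 0 ≤ c := div_nonneg (hq l hls) hgl.le
    have hnonneg : ∀ i ∈ s, 0 ≤ q i - c * g i := by
      intro i hi
      rcases le_or_gt (g i) 0 with h | h
      · nlinarith [hq i hi, mul_nonneg hc0 (neg_nonneg.2 h)]
      · have := hmin i (Finset.mem_filter.2 ⟨hi, h⟩)
        rw [le_div_iff₀ h] at this
        linarith
    have hzero : q l - c * g l = 0 := by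
      rw [hc, div_mul_cancel₀ _ hgl.ne', sub_self]
    obtain ⟨t, hts, hti, r, hr, hsum⟩ := ih (s.erase l) (Finset.erase_ssubset hls)
      (fun i ↦ q i - c * g i) fun i hi ↦ hnonneg i (Finset.mem_of_mem_erase hi)
    refine ⟨t, hts.trans (Finset.erase_subset _ _), hti, r, hr, ?_⟩
    rw [hsum, Finset.sum_erase s (by rw [hzero, zero_smul])]
    simp only [sub_smul, mul_smul, Finset.sum_sub_distrib, ← Finset.smul_sum, hg0, smul_zero,
      sub_zero]

section FinitelyGeneratedCone

variable {ι E : Type*} [Fintype ι] [NormedAddCommGroup E] [NormedSpace ℝ E]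

/-- A finitely generated convex cone is closed. -/
theorem isClosed_conic_combinations (v : ι → E) :
    IsClosed {x | ∃ q : ι → ℝ, (∀ i, 0 ≤ q i) ∧ ∑ i, q i • v i = x} := by
  classical
  have key : {x | ∃ q : ι → ℝ, (∀ i, 0 ≤ q i) ∧ ∑ i, q i • v i = x} =
      ⋃ t : {t : Finset ι // LinearIndepOn ℝ v (t : Set ι)},
        Fintype.linearCombination ℝ (fun i : (t : Finset ι) ↦ v i) '' Set.Ici 0 := by
    ext x
    simp only [Set.mem_ofPred_eq, Set.mem_iUnion, Set.mem_image, Set.mem_Ici,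
      Fintype.linearCombination_apply]
    constructor
    · rintro ⟨q, hq, rfl⟩
      obtain ⟨t, -, ht, r, hr, hsum⟩ :=
        exists_linearIndepOn_conic_combination v Finset.univ q fun i _ ↦ hq i
      refine ⟨⟨t, ht⟩, fun i ↦ r i, fun i ↦ hr i i.2, ?_⟩
      rw [← hsum, ← Finset.sum_coe_sort t]
    · rintro ⟨⟨t, ht⟩, r, hr, rfl⟩
      refine ⟨fun i ↦ if h : i ∈ t then r ⟨i, h⟩ else 0, fun i ↦ ?_, ?_⟩
      · by_cases h : i ∈ t
        · simpa [h] using hr ⟨i, h⟩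
        · simp [h]
      · rw [← Finset.sum_subset (Finset.subset_univ t) (fun i _ hi ↦ by simp [hi]),
          ← Finset.sum_coe_sort t]
        simp
  rw [key]
  refine isClosed_iUnion_of_finite fun t ↦ ?_
  have hinj : LinearMap.ker (Fintype.linearCombination ℝ fun i : (t : Finset ι) ↦ v i) = ⊥ :=
    LinearMap.ker_eq_bot.2 t.2.fintypeLinearCombination_injective
  exact (LinearMap.isClosedEmbedding_of_injective hinj).isClosedMap _ isClosed_Ici

/-- **Farkas' lemma** for a finitely generated convex cone. -/
theorem exists_separating_of_not_conic_combination (v : ι → E) {x : E}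
    (hx : ¬∃ q : ι → ℝ, (∀ i, 0 ≤ q i) ∧ ∑ i, q i • v i = x) :
    ∃ f : StrongDual ℝ E, (∀ i, f (v i) ≤ 0) ∧ 0 < f x := by
  classical
  have hconv : Convex ℝ {x | ∃ q : ι → ℝ, (∀ i, 0 ≤ q i) ∧ ∑ i, q i • v i = x} := by
    rintro _ ⟨q, hq, rfl⟩ _ ⟨r, hr, rfl⟩ a b ha hb -
    refine ⟨fun i ↦ a * q i + b * r i,
      fun i ↦ add_nonneg (mul_nonneg ha (hq i)) (mul_nonneg hb (hr i)), ?_⟩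
    simp only [add_smul, mul_smul, Finset.sum_add_distrib, Finset.smul_sum]
  obtain ⟨f, u, hf, hu⟩ :=
    geometric_hahn_banach_closed_point hconv (isClosed_conic_combinations v) hx
  have hu0 : 0 < u := by simpa using hf 0 ⟨0, by simp, by simp⟩
  refine ⟨f, fun i ↦ ?_, hu0.trans hu⟩
  by_contra! hi
  have := hf ((u / f (v i)) • v i) ⟨Pi.single i (u / f (v i)), fun j ↦ ?_, ?_⟩
  · rw [map_smul, smul_eq_mul, div_mul_cancel₀ _ hi.ne'] at this
    exact this.false
  · have hnonneg : 0 ≤ Pi.single (M := fun _ ↦ ℝ) i (u / f (v i)) :=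
      Pi.single_nonneg.2 (div_pos hu0 hi).le
    exact hnonneg j
  · rw [Finset.sum_eq_single i (fun j _ hj ↦ by simp [hj]) (by simp), Pi.single_eq_same]

end FinitelyGeneratedCone

/-- The vectors that are componentwise below some element of the column space of a matrix form a
closed set. -/
theorem isClosed_le_mulVec {κ ν : Type*} [Fintype κ] [Fintype ν] (M : Matrix ν κ ℝ) :
    IsClosed {c : ν → ℝ | ∃ z : κ → ℝ, ∀ j, c j ≤ M.mulVec z j} := by
  classical
  suffices h : {c : ν → ℝ | ∃ z : κ → ℝ, ∀ j, c j ≤ M.mulVec z j} =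
      {x | ∃ q : (κ ⊕ κ) ⊕ ν → ℝ, (∀ i, 0 ≤ q i) ∧
        ∑ i, q i • Sum.elim (Sum.elim M.col fun l ↦ -M.col l)
          (fun j : ν ↦ -Pi.single (M := fun _ ↦ ℝ) j 1) i = x} from
    h ▸ isClosed_conic_combinations _
  ext c
  have hsum : ∀ s : ν → ℝ, ∑ j, s j • (-Pi.single (M := fun _ ↦ ℝ) j 1) = -s := by
    intro s
    ext i
    simp [Finset.sum_apply, Pi.single_apply]
  have hcol : ∀ z : κ → ℝ, ∑ l, z l • M.col l = M.mulVec z := by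
    intro z
    ext i
    simp [Finset.sum_apply, Matrix.mulVec, dotProduct, mul_comm]
  simp only [Set.mem_ofPred_eq, Fintype.sum_sum_type, Sum.elim_inl, Sum.elim_inr, hsum]
  constructor
  · rintro ⟨z, hz⟩
    refine ⟨Sum.elim (Sum.elim (fun l ↦ (z l)⁺) fun l ↦ (z l)⁻) fun j ↦ M.mulVec z j - c j,
      ?_, ?_⟩
    · rintro ((l | l) | j)
      · exact posPart_nonneg _
      · exact negPart_nonneg _
      · exact sub_nonneg.2 (hz j)
    · have hz' : M.mulVec z = ∑ l, (z l)⁺ • M.col l + ∑ l, (z l)⁻ • -M.col l := by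
        rw [← hcol, ← Finset.sum_add_distrib]
        refine Finset.sum_congr rfl fun l _ ↦ ?_
        rw [smul_neg, ← sub_eq_add_neg, ← sub_smul, posPart_sub_negPart]
      simp only [Sum.elim_inl, Sum.elim_inr]
      rw [← hz']
      ext j
      simp
  · rintro ⟨q, hq, rfl⟩
    refine ⟨fun l ↦ q (.inl (.inl l)) - q (.inl (.inr l)), fun j ↦ ?_⟩
    rw [← hcol]
    have := hq (.inr j)
    simp only [sub_smul, smul_neg, Finset.sum_neg_distrib, Finset.sum_sub_distrib, Pi.add_apply,
      Pi.neg_apply, Pi.sub_apply]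
    linarith

/-- A compact set has an undominated extreme point among the maximizers of any linear functional
with nonnegative coefficients. -/
theorem IsCompact.exists_undominated_extremePoint {μ : Type*} [Fintype μ] {Q : Set (μ → ℝ)}
    (hQ : IsCompact Q) (hne : Q.Nonempty) {p : μ → ℝ} (hp : ∀ i, 0 ≤ p i) :
    ∃ y ∈ Set.extremePoints ℝ Q, (¬∃ y' ∈ Q, y' ≠ y ∧ ∀ i, y i ≤ y' i) ∧
      ∀ w ∈ Q, ∑ i, w i * p i ≤ ∑ i, y i * p i := by
  let f : StrongDual ℝ (μ → ℝ) := ∑ i, p i • ContinuousLinearMap.proj i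
  let g : StrongDual ℝ (μ → ℝ) := ∑ i, ContinuousLinearMap.proj i
  have hf : ∀ w, f w = ∑ i, w i * p i := fun w ↦ by
    simp [f, mul_comm]
  have hg : ∀ w, g w = ∑ i, w i := fun w ↦ by simp [g]
  have hF : IsExposed ℝ Q (f.toExposed Q) := fun _ ↦ ⟨f, rfl⟩
  have hG : IsExposed ℝ (f.toExposed Q) (g.toExposed (f.toExposed Q)) := fun _ ↦ ⟨g, rfl⟩
  have hFc : IsCompact (f.toExposed Q) := hF.isCompact hQ
  obtain ⟨a, haQ, ha⟩ := hQ.exists_isMaxOn hne f.continuous.continuousOn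
  obtain ⟨b, hbF, hb⟩ := hFc.exists_isMaxOn ⟨a, haQ, ha⟩ g.continuous.continuousOn
  obtain ⟨y, hy⟩ := (hG.isCompact hFc).extremePoints_nonempty ⟨b, hbF, hb⟩
  obtain ⟨⟨hyQ, hyf⟩, hyg⟩ := hy.1
  refine ⟨y, (hF.isExtreme.trans hG.isExtreme).extremePoints_subset_extremePoints hy, ?_,
    fun w hw ↦ by simpa only [hf] using hyf w hw⟩
  rintro ⟨y', hy'Q, hne', hle⟩
  have hfle : f y ≤ f y' := by
    rw [hf, hf]
    exact Finset.sum_le_sum fun i _ ↦ mul_le_mul_of_nonneg_right (hle i) (hp i)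
  have hgle := hyg y' ⟨hy'Q, fun w hw ↦ (hyf w hw).trans hfle⟩
  rw [hg, hg] at hgle
  have hlt : ∑ i, y i < ∑ i, y' i :=
    Fintype.sum_strictMono (lt_of_le_of_ne hle hne'.symm)
  exact hgle.not_gt hlt

/-- **Farkas' lemma** for the cone `{A q : q ≥ 0, R q = 0}`. -/
theorem exists_dual_of_notMem_cone {μ ν κ : Type*} [Fintype μ] [Fintype ν] [Fintype κ]
    (A : Matrix μ ν ℝ) (R : Matrix κ ν ℝ) {p : μ → ℝ}
    (hp : ¬∃ q : ν → ℝ, (∀ i, 0 ≤ q i) ∧ R.mulVec q = 0 ∧ p = A.mulVec q) :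
    ∃ (y : μ → ℝ) (z : κ → ℝ), (∀ j, A.transpose.mulVec y j ≤ R.transpose.mulVec z j) ∧
      0 < ∑ i, y i * p i := by
  classical
  have hsum : ∀ q : ν → ℝ, ∑ j, q j • (A.col j, R.col j) = (A.mulVec q, R.mulVec q) := by
    intro q
    ext i <;>
      simp [Prod.fst_sum, Prod.snd_sum, Finset.sum_apply, Matrix.mulVec, dotProduct, mul_comm]
  obtain ⟨f, hf, hfp⟩ := exists_separating_of_not_conic_combination
    (fun j ↦ (A.col j, R.col j)) (x := (p, (0 : κ → ℝ))) (by
      rintro ⟨q, hq, h⟩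
      rw [hsum, Prod.mk.injEq] at h
      exact hp ⟨q, hq, h.2, h.1.symm⟩)
  let y : μ → ℝ := fun i ↦ f (Pi.single i 1, 0)
  let z : κ → ℝ := fun l ↦ f (0, Pi.single l 1)
  have hfyz : ∀ a b, f (a, b) = ∑ i, y i * a i + ∑ l, z l * b l := by
    intro a b
    have h1 := (f.toLinearMap ∘ₗ LinearMap.inl ℝ _ _).pi_apply_eq_sum_univ a
    have h2 := (f.toLinearMap ∘ₗ LinearMap.inr ℝ _ _).pi_apply_eq_sum_univ b
    have h3 : f (a, b) = f (a, 0) + f (0, b) := by rw [← map_add]; simp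
    rw [h3]
    congr 1
    · refine h1.trans (Finset.sum_congr rfl fun i _ ↦ ?_)
      rw [smul_eq_mul, mul_comm]
      congr 2
      simp only [y, LinearMap.comp_apply, LinearMap.inl_apply, ContinuousLinearMap.coe_coe]
      congr 2
      ext j
      simp [Pi.single_apply, eq_comm]
    · refine h2.trans (Finset.sum_congr rfl fun i _ ↦ ?_)
      rw [smul_eq_mul, mul_comm]
      congr 2
      simp only [z, LinearMap.comp_apply, LinearMap.inr_apply, ContinuousLinearMap.coe_coe]
      congr 2
      ext j
      simp [Pi.single_apply, eq_comm]
  refine ⟨y, -z, fun j ↦ ?_, by simpa [hfyz] using hfp⟩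
  have := hf j
  simp only [hfyz, Matrix.col_apply] at this
  rw [Matrix.mulVec_neg]
  simp only [Pi.neg_apply, Matrix.mulVec, dotProduct, Matrix.transpose_apply, mul_comm (A _ j),
    mul_comm (R _ j)]
  linarith


/-- The discrete choice cone `C ⊆ ℝ₊^m` is characterized by the undominated
extreme points of the dual discrete choice polytope `Q₀`. -/
theorem stmt3 (m n k : ℕ) (A : Matrix (Fin m) (Fin n) ℝ) (R : Matrix (Fin k) (Fin n) ℝ)
    (C : Set (Fin m → ℝ))
    (hC : C = {p | ∃ q : Fin n → ℝ, (∀ i, 0 ≤ q i) ∧ R.mulVec q = 0 ∧ p = A.mulVec q})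
    (Q₀ : Set (Fin m → ℝ))
    (hQ₀ : Q₀ = {y | (∃ z : Fin k → ℝ, ∀ j, A.transpose.mulVec y j ≤ R.transpose.mulVec z j)
        ∧ ∀ i, |y i| ≤ 1})
    (hpos : ∀ p ∈ C, ∀ i, 0 ≤ p i) :
    C = {p | (∀ i, 0 ≤ p i) ∧
      ∀ y ∈ Set.extremePoints ℝ Q₀,
        (¬∃ y' ∈ Q₀, y' ≠ y ∧ ∀ i, y i ≤ y' i) → ∑ i, y i * p i ≤ 0} := by
  have hcomp : IsCompact Q₀ := by
    refine (isCompact_closedBall (0 : Fin m → ℝ) 1).of_isClosed_subset ?_ ?_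
    · rw [hQ₀, Set.ofPred_and]
      refine IsClosed.inter ?_ ?_
      · exact (isClosed_le_mulVec R.transpose).preimage
          (Matrix.mulVecLin A.transpose).continuous_of_finiteDimensional
      · simp only [Set.ofPred_forall]
        exact isClosed_iInter fun i ↦ isClosed_le (continuous_apply i).abs continuous_const
    · intro y hy
      rw [hQ₀] at hy
      rw [mem_closedBall_zero_iff, pi_norm_le_iff_of_nonneg zero_le_one]
      exact hy.2
  have hzero : (0 : Fin m → ℝ) ∈ Q₀ := by
    rw [hQ₀]
    exact ⟨⟨0, by simp⟩, by simp⟩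
  apply Set.Subset.antisymm
  · intro p hp
    refine ⟨hpos p hp, fun y hy _ ↦ ?_⟩
    have hyQ := hy.1
    rw [hQ₀] at hyQ
    obtain ⟨⟨z, hz⟩, -⟩ := hyQ
    rw [hC] at hp
    obtain ⟨q, hq, hRq, rfl⟩ := hp
    calc ∑ i, y i * A.mulVec q i = A.transpose.mulVec y ⬝ᵥ q := by
          rw [Matrix.mulVec_transpose, ← Matrix.dotProduct_mulVec]
          rfl
      _ ≤ R.transpose.mulVec z ⬝ᵥ q :=
          Finset.sum_le_sum fun j _ ↦ mul_le_mul_of_nonneg_right (hz j) (hq j)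
      _ = 0 := by
          rw [Matrix.mulVec_transpose, ← Matrix.dotProduct_mulVec, hRq, dotProduct_zero]
  · rintro p ⟨hp, hpy⟩
    by_contra hpC
    rw [hC] at hpC
    obtain ⟨y, z, hyz, hyp⟩ := exists_dual_of_notMem_cone A R hpC
    have hc : 0 < (1 + ‖y‖)⁻¹ := by positivity
    have hmem : (1 + ‖y‖)⁻¹ • y ∈ Q₀ := by
      rw [hQ₀]
      refine ⟨⟨(1 + ‖y‖)⁻¹ • z, fun j ↦ ?_⟩, fun i ↦ ?_⟩
      · simp only [Matrix.mulVec_smul, Pi.smul_apply, smul_eq_mul]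
        exact mul_le_mul_of_nonneg_left (hyz j) hc.le
      · have hi : |y i| ≤ ‖y‖ := norm_le_pi_norm y i
        rw [Pi.smul_apply, smul_eq_mul, abs_mul, abs_of_pos hc, inv_mul_le_one₀ (by positivity)]
        linarith
    obtain ⟨w, hw, hund, hmax⟩ := hcomp.exists_undominated_extremePoint ⟨0, hzero⟩ hp
    have h1 := (hmax _ hmem).trans (hpy w hw hund)
    simp only [Pi.smul_apply, smul_eq_mul, mul_assoc, ← Finset.mul_sum] at h1
    exact h1.not_gt (mul_pos hc hyp)
end

section
/- Let S = {((1−r)(1−s), (1−r)s, r(1−s), rs) ∈ ℝ⁴ : r, s ∈ ℝ, 0 ≤ s ≤ r ≤ 1}. Then the convex hull of S is a compact convex subset of ℝ⁴ that is not a polytope: there do not exist finitely many pairs (αᵢ, βᵢ) ∈ ℝ⁴ × ℝ such that conv(S) = {p ∈ ℝ⁴ : αᵢᵀ p ≤ βᵢ for all i}. -/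
/-- In a finite-dimensional space, the convex hull of a compact set is compact. -/
theorem IsCompact.convexHull_of_finiteDimensional {E : Type*} [NormedAddCommGroup E]
    [NormedSpace ℝ E] [FiniteDimensional ℝ E] {s : Set E} (hs : IsCompact s) :
    IsCompact (convexHull ℝ s) := by
  let n := Module.finrank ℝ E + 1
  have hK : IsCompact (stdSimplex ℝ (Fin n) ×ˢ Set.univ.pi fun _ : Fin n => s) :=
    (isCompact_stdSimplex ℝ (Fin n)).prod (isCompact_univ_pi fun _ => hs)
  have hf : Continuous fun x : (Fin n → ℝ) × (Fin n → E) => ∑ i, x.1 i • x.2 i := by fun_prop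
  convert hK.image hf using 1
  refine Set.Subset.antisymm (fun x hx => ?_) ?_
  · obtain ⟨x₀, hx₀⟩ := convexHull_nonempty_iff.1 ⟨x, hx⟩
    obtain ⟨ι, _, z, w, hz, hind, hw, hsum, rfl⟩ := eq_pos_convex_span_of_mem_convexHull hx
    have hcard : Fintype.card ι ≤ Fintype.card (Fin n) := by
      rw [Fintype.card_fin]
      exact hind.card_le_finrank_succ.trans (Nat.succ_le_succ (Submodule.finrank_le _))
    obtain ⟨e⟩ := Function.Embedding.nonempty_of_card_le hcard
    have hext : ∀ j, j ∉ Set.range e → Function.extend e w 0 j = 0 := fun j hj => by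
      rw [Function.extend_apply' _ _ _ hj]; rfl
    refine ⟨(Function.extend e w 0, Function.extend e z fun _ => x₀),
      ⟨⟨fun j => ?_, ?_⟩, fun j _ => ?_⟩, ?_⟩
    · by_cases hj : j ∈ Set.range e
      · obtain ⟨i, rfl⟩ := hj
        simpa only [e.injective.extend_apply] using (hw i).le
      · exact (hext j hj).ge
    · rw [← hsum]
      exact (Fintype.sum_of_injective e e.injective _ _ hext
        fun i => (e.injective.extend_apply w 0 i).symm).symm
    · by_cases hj : j ∈ Set.range e
      · obtain ⟨i, rfl⟩ := hj
        simpa only [e.injective.extend_apply] using hz ⟨i, rfl⟩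
      · simpa only [Function.extend_apply' _ _ _ hj] using hx₀
    · refine (Fintype.sum_of_injective e e.injective _ _ (fun j hj => ?_) fun i => ?_).symm
      · simp only [hext j hj, zero_smul]
      · simp only [e.injective.extend_apply]
  · rintro _ ⟨⟨w, z⟩, ⟨⟨hw, hsum⟩, hz⟩, rfl⟩
    exact (convex_convexHull ℝ s).sum_mem (fun i _ => hw i) hsum
      fun i _ => subset_convexHull ℝ s (hz i trivial)

/-- A quadratic with nonzero leading coefficient has finitely many roots. -/
theorem finite_setOf_quadratic_eq_zero {a b c : ℝ} (ha : a ≠ 0) :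
    {t : ℝ | a * t ^ 2 + b * t + c = 0}.Finite := by
  let p : Polynomial ℝ :=
    Polynomial.C a * Polynomial.X ^ 2 + Polynomial.C b * Polynomial.X + Polynomial.C c
  have hp : p ≠ 0 := fun h => ha <| by
    simpa [p, Polynomial.coeff_X, Polynomial.coeff_C] using congrArg (Polynomial.coeff · 2) h
  refine p.roots.toFinset.finite_toSet.subset fun t ht => ?_
  simpa [hp, p] using ht

theorem isCompact_setOf_prod_probabilities :
    IsCompact {p : Fin 4 → ℝ | ∃ r s : ℝ, 0 ≤ s ∧ s ≤ r ∧ r ≤ 1 ∧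
      p = ![(1 - r) * (1 - s), (1 - r) * s, r * (1 - s), r * s]} := by
  have hK : IsCompact ((Set.Icc (0 : ℝ) 1 ×ˢ Set.Icc (0 : ℝ) 1) ∩ {x | x.2 ≤ x.1}) :=
    (isCompact_Icc.prod isCompact_Icc).inter_right (isClosed_le continuous_snd continuous_fst)
  have hf : Continuous fun x : ℝ × ℝ =>
      ![(1 - x.1) * (1 - x.2), (1 - x.1) * x.2, x.1 * (1 - x.2), x.1 * x.2] := by
    refine continuous_pi fun i => ?_
    fin_cases i <;> simp <;> fun_prop
  convert hK.image hf using 1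
  ext p
  constructor
  · rintro ⟨r, s, h0, hsr, h1, rfl⟩
    exact ⟨(r, s), ⟨⟨⟨h0.trans hsr, h1⟩, h0, hsr.trans h1⟩, hsr⟩, rfl⟩
  · rintro ⟨⟨r, s⟩, ⟨⟨⟨_, h1⟩, h0, _⟩, hsr⟩, rfl⟩
    exact ⟨r, s, h0, hsr, h1, rfl⟩

/-- An inequality valid on the convex hull; among diagonal points it is tight only at `t`. -/
theorem supporting_inequality {t : ℝ} (ht0 : 0 ≤ t) {p : Fin 4 → ℝ}
    (hp : p ∈ convexHull ℝ {p : Fin 4 → ℝ | ∃ r s : ℝ, 0 ≤ s ∧ s ≤ r ∧ r ≤ 1 ∧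
      p = ![(1 - r) * (1 - s), (1 - r) * s, r * (1 - s), r * s]}) :
    0 ≤ p 3 - t * (p 1 + p 2 + 2 * p 3) + t ^ 2 * (p 0 + p 1 + p 2 + p 3) + (p 2 - p 1) := by
  have hconv : Convex ℝ {p : Fin 4 → ℝ |
      0 ≤ p 3 - t * (p 1 + p 2 + 2 * p 3) + t ^ 2 * (p 0 + p 1 + p 2 + p 3) + (p 2 - p 1)} := by
    intro x hx y hy a b ha hb _
    simp only [Set.mem_ofPred_eq, Pi.add_apply, Pi.smul_apply, smul_eq_mul] at *
    linarith [mul_nonneg ha hx, mul_nonneg hb hy]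
  refine convexHull_min ?_ hconv hp
  rintro _ ⟨r, s, h0, hsr, h1, rfl⟩
  simp only [Set.mem_ofPred_eq, Matrix.cons_val]
  have key : 0 ≤ (r - t) * (s - t) + (r - s) := by
    rcases le_total r t with h | h
    · nlinarith [mul_nonneg (sub_nonneg.2 h) (sub_nonneg.2 (hsr.trans h))]
    · rcases le_total t s with h' | h'
      · nlinarith [mul_nonneg (sub_nonneg.2 h) (sub_nonneg.2 h')]
      · nlinarith [mul_nonneg (sub_nonneg.2 h') (show 0 ≤ 1 - (r - t) by linarith)]
  linarith

/-- Proposition (propImp): the set of CCP vectors consistent with the conditional IID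
restriction is compact and convex but is not a polytope. -/
theorem stmt5 (S : Set (Fin 4 → ℝ))
    (hS : S = {p | ∃ r s : ℝ, 0 ≤ s ∧ s ≤ r ∧ r ≤ 1 ∧
      p = ![(1 - r) * (1 - s), (1 - r) * s, r * (1 - s), r * s]}) :
    IsCompact (convexHull ℝ S) ∧ Convex ℝ (convexHull ℝ S) ∧
      ¬∃ (m : ℕ) (α : Fin m → Fin 4 → ℝ) (β : Fin m → ℝ),
        convexHull ℝ S = {p | ∀ i, ∑ j, α i j * p j ≤ β i} := by
  refine ⟨?_, convex_convexHull ℝ S, ?_⟩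
  · rw [hS]
    exact isCompact_setOf_prod_probabilities.convexHull_of_finiteDimensional
  rintro ⟨m, α, β, h⟩
  -- The second-order coefficient of the `i`-th constraint along the diagonal `r = s`.
  let c : Fin m → ℝ := fun i => α i 0 - α i 1 - α i 2 + α i 3
  let q : Fin m → ℝ → ℝ := fun i t =>
    c i * t ^ 2 + (α i 1 + α i 2 - 2 * α i 0) * t + (α i 0 - β i)
  have hfin : (⋃ i, {t | c i ≠ 0 ∧ q i t = 0}).Finite := by
    refine Set.finite_iUnion fun i => ?_
    by_cases hc : c i = 0
    · simp [hc]
    · exact (finite_setOf_quadratic_eq_zero hc).subset fun t ht => ht.2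
  obtain ⟨t, ⟨ht0, ht1⟩, ht⟩ :=
    (Set.Ioo_infinite (zero_lt_one (α := ℝ))).exists_notMem_finite hfin
  simp only [Set.mem_iUnion, Set.mem_ofPred_eq, not_exists, not_and] at ht
  have hq : ∀ i, q i t ≤ 0 := by
    have hmem : ![(1 - t) * (1 - t), (1 - t) * t, t * (1 - t), t * t] ∈ convexHull ℝ S :=
      subset_convexHull ℝ S (hS ▸ ⟨t, t, ht0.le, le_rfl, ht1.le, rfl⟩)
    rw [h] at hmem
    intro i
    have := hmem i
    simp only [Fin.sum_univ_four, Matrix.cons_val] at this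
    simp only [q, c]
    linarith
  have hε : ∀ᶠ ε in nhdsWithin (0 : ℝ) (Set.Ioi 0), ∀ i, q i t - ε * c i ≤ 0 := by
    refine Filter.eventually_all.2 fun i => ?_
    by_cases hc : c i = 0
    · simp [hc, hq i]
    · have hlt : q i t - 0 * c i < 0 := by simpa using lt_of_le_of_ne (hq i) (ht i hc)
      have hcont : Continuous fun ε : ℝ => q i t - ε * c i := by fun_prop
      exact nhdsWithin_le_nhds
        ((hcont.continuousAt.eventually_lt continuousAt_const hlt).mono fun _ h => h.le)
  obtain ⟨ε, hεq, hεpos⟩ := (hε.and self_mem_nhdsWithin).exists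
  have hw : ![(1 - t) * (1 - t) - ε, (1 - t) * t + ε, t * (1 - t) + ε, t * t - ε]
      ∈ convexHull ℝ S := by
    rw [h]
    intro i
    have := hεq i
    simp only [q, c] at this
    simp only [Fin.sum_univ_four, Matrix.cons_val]
    linarith
  rw [hS] at hw
  have := supporting_inequality ht0.le hw
  simp only [Matrix.cons_val] at this
  have : (0 : ℝ) < ε := hεpos
  nlinarith
end

section
/- Fix an integer D ≥ 2 and let Q_E ⊆ ℝ^{D×D} be the polytope of all matrices y = (y_{c,d})_{c,d ∈ {1,…,D}} satisfying y_{c,d} ≥ −1 for all c, d, and y_{c,d'} + y_{c',d} ≤ 0 for all c, c', d, d' ∈ {1,…,D} with c ≤ d and c' ≤ d'. Then Q_E is integral: every extreme point of Q_E has all of its entries in {−1, 0, 1}. -/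
open Filter Topology in
/-- An affine inequality valid at `0` persists near `0` if it is strict or has zero slope. -/
theorem eventually_add_mul_nonpos {a b : ℝ} (ha : a ≤ 0) (hab : a = 0 → b = 0) :
    ∀ᶠ ε : ℝ in 𝓝 0, a + ε * b ≤ 0 := by
  rcases ha.lt_or_eq with h | h
  · have hc : ContinuousAt (fun ε : ℝ => a + ε * b) 0 := by fun_prop
    exact (hc.eventually_lt continuousAt_const (by simpa using h)).mono fun _ => le_of_lt
  · simp [h, hab h]

open Filter Topology in
/-- A point of a set which can be moved slightly in both directions `w` and `-w` is extreme only
if `w = 0`. -/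
theorem eq_zero_of_mem_extremePoints_of_eventually {E : Type*} [AddCommGroup E] [Module ℝ E]
    {s : Set E} {y w : E} (hy : y ∈ Set.extremePoints ℝ s)
    (h : ∀ᶠ ε : ℝ in 𝓝 0, y + ε • w ∈ s) : w = 0 := by
  obtain ⟨r, hr, hball⟩ := Metric.eventually_nhds_iff.1 h
  have hp : y + (r / 2) • w ∈ s := hball (by
    rw [Real.dist_eq, sub_zero, abs_of_pos (by positivity)]; linarith)
  have hn : y + (-(r / 2)) • w ∈ s := hball (by
    rw [Real.dist_eq, sub_zero, abs_neg, abs_of_pos (by positivity)]; linarith)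
  have hseg : y ∈ openSegment ℝ (y + (r / 2) • w) (y + (-(r / 2)) • w) :=
    ⟨1 / 2, 1 / 2, by norm_num, by norm_num, by norm_num, by module⟩
  have heq := hy.2 hp hn hseg
  have hzero : (r / 2) • w = 0 := by simpa using heq
  exact (smul_eq_zero.1 hzero).resolve_left (by positivity)

/-- Theorem (thmIntE), exchangeable part: the dual discrete choice polytope `Q_E` is
integral, i.e. every extreme point has entries in `{-1, 0, 1}`. -/
theorem stmt6 (D : ℕ) (hD : 2 ≤ D)
    (QE : Set (Fin D → Fin D → ℝ))
    (hQE : QE = {y | (∀ c d, -1 ≤ y c d) ∧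
      ∀ c c' d d' : Fin D, c ≤ d → c' ≤ d' → y c d' + y c' d ≤ 0}) :
    ∀ y ∈ Set.extremePoints ℝ QE, ∀ c d, y c d = -1 ∨ y c d = 0 ∨ y c d = 1 := by
  classical
  intro y hy c₀ d₀
  by_contra! hne
  obtain ⟨hneg, hzero, hone⟩ := hne
  have habs : |y c₀ d₀| ≠ 1 := fun h => by
    rcases eq_or_eq_neg_of_abs_eq h with h | h
    exacts [hone h, hneg h]
  -- Scale all entries of the same absolute value as the non-integral one.
  let w : Fin D → Fin D → ℝ := fun c d => if |y c d| = |y c₀ d₀| then y c d else 0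
  have hyQ := hy.1
  rw [hQE] at hyQ
  have hw : w = 0 := by
    refine eq_zero_of_mem_extremePoints_of_eventually hy ?_
    have hlower : ∀ᶠ ε : ℝ in nhds 0, ∀ c d, -1 - y c d + ε * -w c d ≤ 0 := by
      simp only [Filter.eventually_all]
      refine fun c d => eventually_add_mul_nonpos (by linarith [hyQ.1 c d]) fun h => ?_
      have hcd : y c d = -1 := by linarith
      simp [w, hcd, habs.symm]
    have hpair : ∀ᶠ ε : ℝ in nhds 0, ∀ c c' d d' : Fin D, c ≤ d → c' ≤ d' →
        y c d' + y c' d + ε * (w c d' + w c' d) ≤ 0 := by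
      simp only [Filter.eventually_all]
      refine fun c c' d d' h h' => eventually_add_mul_nonpos (hyQ.2 c c' d d' h h') fun h0 => ?_
      have hcd : y c d' = -y c' d := by linarith
      simp only [w, hcd, abs_neg]
      split_ifs <;> simp
    filter_upwards [hlower, hpair] with ε h₁ h₂
    rw [hQE]
    refine ⟨fun c d => ?_, fun c c' d d' h h' => ?_⟩
    · simp only [Pi.add_apply, Pi.smul_apply, smul_eq_mul]
      linarith [h₁ c d]
    · simp only [Pi.add_apply, Pi.smul_apply, smul_eq_mul]
      linarith [h₂ c c' d d' h h']
  apply hzero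
  simpa [w] using congrFun (congrFun hw c₀) d₀
end

section
/- Fix an integer D ≥ 2 and let Q_E ⊆ ℝ^{D×D} be the polytope of all matrices y = (y_{c,d})_{c,d ∈ {1,…,D}} satisfying y_{c,d} ≥ −1 for all c, d, and y_{c,d'} + y_{c',d} ≤ 0 for all c, c', d, d' with c ≤ d and c' ≤ d'. Then every undominated extreme point y of Q_E satisfies: (i) y_{c,d} ∈ {0, 1} whenever c > d; (ii) y_{c,d} ∈ {−1, 0} whenever c ≤ d; and (iii) y_{c,d} = −y_{d,c} for all c, d. In particular, every undominated extreme point of Q_E has rank zero, i.e. the sum of all of its entries equals 0. -/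
open Classical in
/-- For a matrix `y` with entries in `{-1, 0, 1}`, the antisymmetric matrix that is `-1` at those
`(a, b)` with `a < b` for which `y` is `-1` at all `(c, d)` with `c ≤ a` and `b ≤ d`, and `0` at the
other `(a, b)` with `a ≤ b`. -/
noncomputable def antisymmHull {D : ℕ} (y : Fin D → Fin D → ℝ) (a b : Fin D) : ℝ :=
  if a < b ∧ ∀ c d, c ≤ a → b ≤ d → y c d = -1 then -1
  else if b < a ∧ ∀ c d, c ≤ b → a ≤ d → y c d = -1 then 1
  else 0

theorem antisymmHull_eq_neg_swap {D : ℕ} (y : Fin D → Fin D → ℝ) (a b : Fin D) :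
    antisymmHull y a b = -antisymmHull y b a := by
  unfold antisymmHull
  split_ifs with h₁ h₂
  · exact absurd h₁.1 h₂.1.not_gt
  all_goals norm_num

theorem antisymmHull_add_nonpos {D : ℕ} (y : Fin D → Fin D → ℝ) {c c' d d' : Fin D}
    (hcd : c ≤ d) (hcd' : c' ≤ d') : antisymmHull y c d' + antisymmHull y c' d ≤ 0 := by
  have key : ∀ a b e f : Fin D, a ≤ f → e ≤ b →
      (b < a ∧ ∀ c d, c ≤ b → a ≤ d → y c d = -1) → antisymmHull y e f = -1 := by
    intro a b e f haf heb h
    exact if_pos ⟨heb.trans_lt (h.1.trans_le haf),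
      fun c d hc hd => h.2 c d (hc.trans heb) (haf.trans hd)⟩
  have le_one : ∀ a b, antisymmHull y a b ≤ 1 := by
    intro a b
    unfold antisymmHull
    split_ifs <;> norm_num
  by_cases h₁ : d' < c ∧ ∀ i j, i ≤ d' → c ≤ j → y i j = -1
  · linarith [key c d' c' d hcd hcd' h₁, le_one c d']
  by_cases h₂ : d < c' ∧ ∀ i j, i ≤ d → c' ≤ j → y i j = -1
  · linarith [key c' d c d' hcd' hcd h₂, le_one c' d]
  unfold antisymmHull
  rw [if_neg h₁, if_neg h₂]
  split_ifs <;> norm_num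

theorem monotoneOn_two_mul_sub_mul_abs :
    MonotoneOn (fun t : ℝ => 2 * t - t * |t|) (Set.Icc (-1) 1) := by
  rintro s ⟨hs, -⟩ t ⟨-, ht⟩ hst
  rcases abs_cases s with ⟨h, h'⟩ | ⟨h, h'⟩ <;> rcases abs_cases t with ⟨k, k'⟩ | ⟨k, k'⟩ <;>
    simp only [h, k] <;> nlinarith

theorem monotone_mul_abs : Monotone (fun t : ℝ => t * |t|) := by
  intro s t hst
  rcases abs_cases s with ⟨h, h'⟩ | ⟨h, h'⟩ <;> rcases abs_cases t with ⟨k, k'⟩ | ⟨k, k'⟩ <;>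
    simp only [h, k] <;> nlinarith

/-- Applying entrywise an odd function that is monotone on `[-1, 1]` and fixes `-1` preserves the
polytope. -/
theorem add_nonpos_of_odd_monotoneOn {D : ℕ} {y : Fin D → Fin D → ℝ} {f : ℝ → ℝ}
    (hf : MonotoneOn f (Set.Icc (-1) 1)) (hodd : ∀ t, f (-t) = -f t) (hf₁ : f (-1) = -1)
    (hy : ∀ c d, y c d ∈ Set.Icc (-1 : ℝ) 1)
    (hadd : ∀ c c' d d' : Fin D, c ≤ d → c' ≤ d' → y c d' + y c' d ≤ 0) :
    (∀ c d, -1 ≤ f (y c d)) ∧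
      ∀ c c' d d' : Fin D, c ≤ d → c' ≤ d' → f (y c d') + f (y c' d) ≤ 0 := by
  refine ⟨fun c d => ?_, fun c c' d d' hcd hcd' => ?_⟩
  · exact hf₁.symm.trans_le (hf (by norm_num) (hy c d) (hy c d).1)
  · have hneg : -y c' d ∈ Set.Icc (-1 : ℝ) 1 :=
      ⟨neg_le_neg (hy c' d).2, neg_le.mp (hy c' d).1⟩
    have h := hf (hy c d') hneg (by linarith [hadd c c' d d' hcd hcd'])
    rw [hodd] at h
    linarith


/-- Every undominated extreme point of the exchangeable dual discrete choice polytope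
`Q_E` has entries in `{0,1}` above the diagonal ordering, in `{-1,0}` on/below it, is
antisymmetric, and has rank (sum of entries) zero. -/
theorem stmt8 (D : ℕ) (hD : 2 ≤ D)
    (QE : Set (Fin D → Fin D → ℝ))
    (hQE : QE = {y | (∀ c d, -1 ≤ y c d) ∧
      ∀ c c' d d' : Fin D, c ≤ d → c' ≤ d' → y c d' + y c' d ≤ 0}) :
    ∀ y ∈ Set.extremePoints ℝ QE,
      (¬∃ y' ∈ QE, y' ≠ y ∧ ∀ c d, y c d ≤ y' c d) →
      (∀ c d : Fin D, d < c → (y c d = 0 ∨ y c d = 1)) ∧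
      (∀ c d : Fin D, c ≤ d → (y c d = -1 ∨ y c d = 0)) ∧
      (∀ c d : Fin D, y c d = - y d c) ∧
      (∑ c : Fin D, ∑ d : Fin D, y c d) = 0 := by
  subst hQE
  intro y hy hund
  obtain ⟨⟨hlow, hadd⟩, hext⟩ := hy
  have hmem : ∀ c d, y c d ∈ Set.Icc (-1 : ℝ) 1 := fun c d =>
    ⟨hlow c d, by linarith [hlow d c, hadd c d c d le_rfl le_rfl]⟩
  have hfix : (fun c d => y c d * |y c d|) = y := by
    refine hext (x₁ := fun c d => y c d * |y c d|)
      (add_nonpos_of_odd_monotoneOn (monotone_mul_abs.monotoneOn _) (by simp) (by simp) hmem hadd)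
      (x₂ := fun c d => 2 * y c d - y c d * |y c d|)
      (add_nonpos_of_odd_monotoneOn monotoneOn_two_mul_sub_mul_abs
        (fun t => by rw [abs_neg]; ring) (by norm_num) hmem hadd)
      ⟨1 / 2, 1 / 2, by norm_num, by norm_num, by norm_num, ?_⟩
    ext c d
    simp only [Pi.add_apply, Pi.smul_apply, smul_eq_mul]
    ring
  have hval : ∀ c d, y c d = -1 ∨ y c d = 0 ∨ y c d = 1 := by
    intro c d
    have h : y c d * (|y c d| - 1) = 0 := by
      linarith [congrFun (congrFun hfix c) d]
    rcases mul_eq_zero.mp h with h | h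
    · exact Or.inr (Or.inl h)
    · rcases eq_or_eq_neg_of_abs_eq (sub_eq_zero.mp h) with h | h
      · exact Or.inr (Or.inr h)
      · exact Or.inl h
  have hnonpos : ∀ c d, c ≤ d → y c d ≤ 0 := fun c d h => by
    linarith [hadd c c d d h h]
  have hhull : antisymmHull y = y := by
    by_contra hne
    refine hund ⟨antisymmHull y, ⟨fun c d => ?_,
      fun c c' d d' => antisymmHull_add_nonpos y⟩, hne, fun c d => ?_⟩
    · unfold antisymmHull
      split_ifs <;> norm_num
    · unfold antisymmHull
      split_ifs with h₁ h₂
      · exact (h₁.2 c d le_rfl le_rfl).le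
      · exact (hmem c d).2
      · rcases le_or_gt c d with h | h
        · exact hnonpos c d h
        · have : ∃ i j, i ≤ d ∧ c ≤ j ∧ y i j ≠ -1 := by
            by_contra! hall
            exact h₂ ⟨h, hall⟩
          obtain ⟨i, j, hi, hj, hij⟩ := this
          have := hadd c i j d hj hi
          rcases hval i j with h' | h' | h'
          · exact absurd h' hij
          all_goals linarith
  have hanti : ∀ c d, y c d = -y d c := fun c d => by
    rw [← hhull]
    exact antisymmHull_eq_neg_swap y c d
  refine ⟨fun c d h => ?_, fun c d h => ?_, hanti, ?_⟩
  · rcases hval c d with h' | h'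
    · linarith [hanti c d, hnonpos d c h.le]
    · exact h'
  · rcases hval c d with h' | h' | h'
    · exact Or.inl h'
    · exact Or.inr h'
    · linarith [hnonpos c d h]
  · have h : ∑ c, ∑ d, y c d = -∑ c, ∑ d, y c d := by
      conv_lhs => rw [Finset.sum_comm]
      simp only [← Finset.sum_neg_distrib]
      exact Finset.sum_congr rfl fun c _ => Finset.sum_congr rfl fun d _ => hanti d c
    linarith
end

section
/- Fix an integer D ≥ 2 and let F = {(a,b) ∈ {1,…,D}² : a ≤ b}. Suppose y ∈ ℝ^{D×D} and z ∈ ℝ^F satisfy y_{a,b} ≥ −1 for all a, b ∈ {1,…,D}, and y_{a,b} ≤ z_{(a,c)} − z_{(d,b)} for all a, b, c, d ∈ {1,…,D} with a ≤ c and d ≤ b. Then y_{a,b} ≤ 1 for all a, b ∈ {1,…,D}. -/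
/-- In the stationary dual discrete choice polytope, the upper bound `y ≤ 1` is
implied by `y ≥ -1` and the constraints `y_{a,b} ≤ z_{(a,c)} - z_{(d,b)}`. -/
theorem stmt9 (D : ℕ) (hD : 2 ≤ D)
    (y : Fin D → Fin D → ℝ)
    (z : {p : Fin D × Fin D // p.1 ≤ p.2} → ℝ)
    (h1 : ∀ a b : Fin D, -1 ≤ y a b)
    (h2 : ∀ (a b c d : Fin D) (hac : a ≤ c) (hdb : d ≤ b),
      y a b ≤ z ⟨(a, c), hac⟩ - z ⟨(d, b), hdb⟩) :
    ∀ a b : Fin D, y a b ≤ 1 := by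
  intro a b
  linarith [h1 b a, h2 b a b a le_rfl le_rfl, h2 a b a b le_rfl le_rfl]
end

section
/- Fix an integer D ≥ 2, let F = {(a,b) ∈ {1,…,D}² : a ≤ b}, and let Q_S ⊆ ℝ^{D×D} be the set of all y = (y_{a,b}) such that y_{a,b} ≥ −1 for all a, b and there exists z ∈ ℝ^F with y_{a,b} ≤ z_{(a,c)} − z_{(d,b)} for all a, b, c, d ∈ {1,…,D} with a ≤ c and d ≤ b. Then Q_S is a polytope and it is integral: every extreme point of Q_S has all of its entries in {−1, 0, 1}. -/
open Filter Topology

/-- An extreme point admits no nonzero symmetric perturbation within the set. -/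
lemma eq_zero_of_mem_extremePoints {E : Type*} [AddCommGroup E] [Module ℝ E] {A : Set E}
    {y w : E} (hy : y ∈ Set.extremePoints ℝ A) (h1 : y + w ∈ A) (h2 : y - w ∈ A) : w = 0 := by
  have h := (mem_extremePoints.1 hy).2 _ h1 _ h2
    ⟨1 / 2, 1 / 2, by norm_num, by norm_num, by norm_num, by module⟩
  simpa using h.1

/-- The lift of the stationary dual discrete choice polytope to row and column potentials. -/
def StationaryLift {D : ℕ} (y : Fin D → Fin D → ℝ) (u v : Fin D → ℝ) : Prop :=
  (∀ a b, -1 ≤ y a b) ∧ (∀ a b, y a b ≤ u a - v b) ∧ ∀ a b, a ≤ b → u a ≤ v b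

namespace StationaryLift

variable {D : ℕ} {y : Fin D → Fin D → ℝ} {u v : Fin D → ℝ}

lemma sub_le_one (h : StationaryLift y u v) (a b : Fin D) : u a - v b ≤ 1 := by
  obtain ⟨h1, h2, h3⟩ := h
  linarith [h1 b a, h2 b a, h3 a a le_rfl, h3 b b le_rfl]

lemma sub_const (h : StationaryLift y u v) (t : ℝ) :
    StationaryLift y (fun a => u a - t) (fun b => v b - t) := by
  obtain ⟨h1, h2, h3⟩ := h
  exact ⟨h1, fun a b => by linarith [h2 a b], fun a b hab => by linarith [h3 a b hab]⟩

end StationaryLift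

/-- The row minima and column maxima of `z` are potentials for `y`, and conversely. -/
lemma exists_stationaryLift_iff {D : ℕ} (y : Fin D → Fin D → ℝ) :
    ((∀ a b, -1 ≤ y a b) ∧ ∃ z : {p : Fin D × Fin D // p.1 ≤ p.2} → ℝ,
        ∀ (a b c d : Fin D) (hac : a ≤ c) (hdb : d ≤ b),
          y a b ≤ z ⟨(a, c), hac⟩ - z ⟨(d, b), hdb⟩) ↔ ∃ u v, StationaryLift y u v := by
  constructor
  · rintro ⟨hy, z, hz⟩
    have (a : Fin D) : Nonempty {c // a ≤ c} := ⟨⟨a, le_rfl⟩⟩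
    have (b : Fin D) : Nonempty {d // d ≤ b} := ⟨⟨b, le_rfl⟩⟩
    refine ⟨fun a => ⨅ c : {c // a ≤ c}, z ⟨(a, c.1), c.2⟩,
      fun b => ⨆ d : {d // d ≤ b}, z ⟨(d.1, b), d.2⟩, hy, fun a b => ?_, fun a b hab => ?_⟩
    · rw [le_sub_comm]
      refine ciSup_le fun (d : {d // d ≤ b}) => ?_
      rw [le_sub_comm, le_sub_iff_add_le]
      exact le_ciInf fun (c : {c // a ≤ c}) => le_sub_iff_add_le.1 (hz a b c d c.2 d.2)
    · exact (ciInf_le (Set.finite_range _).bddBelow (⟨b, hab⟩ : {c // a ≤ c})).trans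
        (le_ciSup (f := fun d : {d // d ≤ b} => z ⟨(d.1, b), d.2⟩)
          (Set.finite_range _).bddAbove ⟨a, hab⟩)
  · rintro ⟨u, v, h1, h2, h3⟩
    exact ⟨h1, fun p => u p.1.1, fun a b c d hac hdb => by linarith [h2 a b, h3 d b hdb]⟩

lemma isCompact_setOf_exists_stationaryLift {D : ℕ} (hD : 0 < D) :
    IsCompact {y : Fin D → Fin D → ℝ | ∃ u v, StationaryLift y u v} := by
  let K : Set ((Fin D → Fin D → ℝ) × (Fin D → ℝ) × (Fin D → ℝ)) :=
    Set.Icc (fun _ _ => -1, fun _ => -1, fun _ => -1) (fun _ _ => 1, fun _ => 1, fun _ => 1)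
  let C : Set ((Fin D → Fin D → ℝ) × (Fin D → ℝ) × (Fin D → ℝ)) :=
    {p | StationaryLift p.1 p.2.1 p.2.2}
  have hK : IsCompact K := isCompact_Icc
  have hC : IsClosed C := by
    simp only [C, StationaryLift, Set.ofPred_and, Set.ofPred_forall]
    refine IsClosed.inter ?_ (IsClosed.inter ?_ ?_)
    · exact isClosed_iInter fun a => isClosed_iInter fun b =>
        isClosed_le (by fun_prop) (by fun_prop)
    · exact isClosed_iInter fun a => isClosed_iInter fun b =>
        isClosed_le (by fun_prop) (by fun_prop)
    · exact isClosed_iInter fun a => isClosed_iInter fun b => isClosed_iInter fun _ =>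
        isClosed_le (by fun_prop) (by fun_prop)
  convert (hK.inter_right hC).image continuous_fst using 1
  ext y
  constructor
  · rintro ⟨u, v, h⟩
    let o : Fin D := ⟨0, hD⟩
    have ho (a : Fin D) : o ≤ a := Nat.zero_le _
    refine ⟨(y, fun a => u a - v o, fun b => v b - v o), ⟨?_, h.sub_const _⟩, rfl⟩
    have h5 := h.sub_le_one
    obtain ⟨h1, h2, h3⟩ := h
    refine ⟨⟨h1, fun a => ?_, fun b => ?_⟩, fun a b => (h2 a b).trans (h5 a b), fun a => ?_,
      fun b => ?_⟩ <;> dsimp only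
    · linarith [h1 a o, h2 a o]
    · linarith [h1 o o, h2 o o, h3 o b (ho b)]
    · exact h5 a o
    · linarith [h1 o b, h2 o b, h3 o o le_rfl]
  · rintro ⟨⟨y', u, v⟩, ⟨-, h⟩, rfl⟩
    exact ⟨u, v, h⟩

/-- At an extreme point, every entry is at its lower or its upper bound. -/
lemma StationaryLift.eq_neg_one_or_eq_sub {D : ℕ} {y : Fin D → Fin D → ℝ} {u v : Fin D → ℝ}
    (h : StationaryLift y u v)
    (hy : y ∈ Set.extremePoints ℝ {y : Fin D → Fin D → ℝ | ∃ u v, StationaryLift y u v})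
    (a b : Fin D) : y a b = -1 ∨ y a b = u a - v b := by
  obtain ⟨h1, h2, h3⟩ := h
  by_contra! hne
  have hl : -1 < y a b := lt_of_le_of_ne (h1 a b) hne.1.symm
  have hr : y a b < u a - v b := lt_of_le_of_ne (h2 a b) hne.2
  obtain ⟨ε, hε, hε'⟩ := exists_between (lt_min (sub_pos.2 hl) (sub_pos.2 hr))
  obtain ⟨hε1, hε2⟩ := lt_min_iff.1 hε'
  have key : ∀ s : ℝ, |s| ≤ ε →
      StationaryLift (fun i j => y i j + if i = a ∧ j = b then s else 0) u v := by
    intro s hs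
    obtain ⟨hs1, hs2⟩ := abs_le.1 hs
    refine ⟨fun i j => ?_, fun i j => ?_, h3⟩ <;> dsimp only <;> split_ifs with hij
    · obtain ⟨rfl, rfl⟩ := hij
      linarith
    · linarith [h1 i j]
    · obtain ⟨rfl, rfl⟩ := hij
      linarith
    · linarith [h2 i j]
  have hw := eq_zero_of_mem_extremePoints (w := fun i j => if i = a ∧ j = b then ε else 0) hy
    ⟨u, v, key ε (abs_of_pos hε).le⟩
    ⟨u, v, by
      convert key (-ε) (by rw [abs_neg, abs_of_pos hε]) using 3 with i j
      simp only [Pi.sub_apply]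
      split_ifs <;> ring⟩
  have := congrFun (congrFun hw a) b
  simp at this
  exact hε.ne' this

lemma exists_pos_forall_le {ι : Type*} [Finite ι] (f : ι → ℝ) :
    ∃ ε : ℝ, 0 < ε ∧ ∀ i, 0 < f i → ε ≤ f i := by
  have h : ∀ᶠ ε in 𝓝[>] (0 : ℝ), ∀ i, 0 < f i → ε ≤ f i := by
    refine eventually_all.2 fun i => ?_
    by_cases hi : 0 < f i
    · filter_upwards [Ioo_mem_nhdsGT hi] with ε hε _ using hε.2.le
    · exact Eventually.of_forall fun _ h => absurd h hi
  obtain ⟨ε, h1, h2⟩ := (h.and self_mem_nhdsWithin).exists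
  exact ⟨ε, h2, h1⟩

open Classical in
/-- The indicator of the residue class of `t` modulo the integers. -/
noncomputable def residueIndicator (t x : ℝ) : ℝ := if ∃ n : ℤ, x - t = n then 1 else 0

lemma residueIndicator_eq_of_sub_eq_int {t x x' : ℝ} (n : ℤ) (h : x - x' = n) :
    residueIndicator t x = residueIndicator t x' := by
  unfold residueIndicator
  congr 1
  refine propext ⟨fun ⟨m, hm⟩ => ⟨m - n, ?_⟩, fun ⟨m, hm⟩ => ⟨m + n, ?_⟩⟩ <;>
    push_cast <;> linarith

lemma abs_residueIndicator_sub_le (t x x' : ℝ) :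
    |residueIndicator t x - residueIndicator t x'| ≤ 1 := by
  unfold residueIndicator
  split_ifs <;> norm_num

/-- Every entry of an extreme point is an integer: otherwise, shift the potentials lying in one
residue class modulo the integers. -/
lemma exists_int_eq_of_mem_extremePoints {D : ℕ} {y : Fin D → Fin D → ℝ}
    (hy : y ∈ Set.extremePoints ℝ {y : Fin D → Fin D → ℝ | ∃ u v, StationaryLift y u v})
    (a b : Fin D) : ∃ n : ℤ, y a b = n := by
  obtain ⟨u, v, h⟩ := hy.1
  have htight := h.eq_neg_one_or_eq_sub hy
  obtain ⟨h1, h2, h3⟩ := h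
  by_contra! hn
  have hne : y a b ≠ -1 := by simpa using hn (-1)
  obtain ⟨ε1, hε1, H1⟩ := exists_pos_forall_le fun p : Fin D × Fin D => y p.1 p.2 + 1
  obtain ⟨ε2, hε2, H2⟩ := exists_pos_forall_le fun p : Fin D × Fin D => u p.1 - v p.2 + 1
  obtain ⟨ε3, hε3, H3⟩ := exists_pos_forall_le fun p : Fin D × Fin D => v p.2 - u p.1
  obtain ⟨ε, hε, hε'⟩ := exists_between (lt_min hε1 (lt_min hε2 hε3))
  simp only [lt_min_iff] at hε'
  obtain ⟨l1, l2, l3⟩ := hε'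
  set χ := residueIndicator (u a)
  have key : ∀ s : ℝ, |s| ≤ ε →
      StationaryLift (fun i j => y i j + if y i j = -1 then 0 else s * (χ (u i) - χ (v j)))
        (fun i => u i + s * χ (u i)) (fun j => v j + s * χ (v j)) := by
    intro s hs
    have hb (i j : Fin D) : |s * (χ (u i) - χ (v j))| ≤ ε := by
      rw [abs_mul]
      exact (mul_le_of_le_one_right (abs_nonneg _) (abs_residueIndicator_sub_le _ _ _)).trans hs
    refine ⟨fun i j => ?_, fun i j => ?_, fun i j hij => ?_⟩ <;> dsimp only
    · obtain ⟨hb1, hb2⟩ := abs_le.1 (hb i j)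
      split_ifs with hij
      · linarith
      · have : -1 < y i j := lt_of_le_of_ne (h1 i j) (Ne.symm hij)
        linarith [H1 (i, j) (by dsimp only; linarith)]
    · obtain ⟨hb1, hb2⟩ := abs_le.1 (hb i j)
      split_ifs with hij
      · rcases (h2 i j).eq_or_lt with he | hlt
        · have : χ (u i) = χ (v j) :=
            residueIndicator_eq_of_sub_eq_int (-1) (by push_cast; linarith)
          rw [this]
          linarith
        · linarith [H2 (i, j) (by dsimp only; linarith)]
      · linarith [(htight i j).resolve_left hij]
    · obtain ⟨hb1, hb2⟩ := abs_le.1 (hb i j)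
      rcases (h3 i j hij).eq_or_lt with he | hlt
      · rw [he]
      · linarith [H3 (i, j) (by dsimp only; linarith)]
  have hw := eq_zero_of_mem_extremePoints
    (w := fun i j => if y i j = -1 then 0 else ε * (χ (u i) - χ (v j))) hy
    ⟨_, _, key ε (abs_of_pos hε).le⟩
    ⟨_, _, by
      convert key (-ε) (by rw [abs_neg, abs_of_pos hε]) using 3 with i j
      simp only [Pi.sub_apply]
      split_ifs <;> ring⟩
  have hab := congrFun (congrFun hw a) b
  have hu : χ (u a) = 1 := if_pos ⟨0, by simp⟩
  have hv : χ (v b) = 0 := by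
    refine if_neg fun ⟨n, hn'⟩ => hn (-n) ?_
    push_cast
    linarith [(htight a b).resolve_left hne]
  simp [hne, hu, hv, hε.ne'] at hab

/-- Proposition (props1): the stationary dual discrete choice polytope `Q_S` is a
polytope (compact) and integral: every extreme point has entries in `{-1, 0, 1}`. -/
theorem stmt10 (D : ℕ) (hD : 2 ≤ D)
    (QS : Set (Fin D → Fin D → ℝ))
    (hQS : QS = {y | (∀ a b, -1 ≤ y a b) ∧
      ∃ z : {p : Fin D × Fin D // p.1 ≤ p.2} → ℝ,
        ∀ (a b c d : Fin D) (hac : a ≤ c) (hdb : d ≤ b),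
          y a b ≤ z ⟨(a, c), hac⟩ - z ⟨(d, b), hdb⟩}) :
    IsCompact QS ∧
    ∀ y ∈ Set.extremePoints ℝ QS, ∀ a b, y a b = -1 ∨ y a b = 0 ∨ y a b = 1 := by
  simp only [exists_stationaryLift_iff] at hQS
  subst hQS
  refine ⟨isCompact_setOf_exists_stationaryLift (by omega), fun y hy a b => ?_⟩
  obtain ⟨u, v, h⟩ := hy.1
  obtain ⟨n, hn⟩ := exists_int_eq_of_mem_extremePoints hy a b
  have hlow := h.1 a b
  have hup := (h.2.1 a b).trans (h.sub_le_one a b)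
  rw [hn] at hlow hup ⊢
  norm_cast at hlow hup ⊢
  omega
end

section
/- Fix D ≥ 2, let F = {(a,b) ∈ {1,…,D}² : a ≤ b} with projections Π₁(a,b) = a and Π₂(a,b) = b, and let w ∈ ℝ^{D×D}. Let G be the bipartite directed graph with vertices F×{1} ∪ F×{2}, arcs 𝔸₁ = {((f,1),(g,2)) : f,g ∈ F} and 𝔸₂ = {((f,2),(f,1)) : f ∈ F}, and I_{d,d'} = {((f,1),(g,2)) : Π₁(f) = d, Π₂(g) = d'}. Let G̃ be the bipartite directed graph with vertices {1,…,D}×{1} ∪ {1,…,D}×{2}, arcs Ã₁ = {((d,1),(d',2)) : d, d' ∈ {1,…,D}} and Ã₂ = {((d',2),(d,1)) : d, d' ∈ {1,…,D}, d ≤ d'}. Then min { Σ_{a∈𝔸₁} χ(a) : χ ≥ 0 a circulation on G with Σ_{a∈I_{d,d'}} χ(a) ≥ w_{d,d'} for all d,d' } = min { Σ_{a∈Ã₁} η(a) : η ≥ 0 a circulation on G̃ with η(((d,1),(d',2))) ≥ w_{d,d'} for all d,d' }. -/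
/-- The set of patches for the two-period stationary model: pairs `(a,b)` with `a ≤ b`. -/
abbrev Patch (D : ℕ) := {p : Fin D × Fin D // p.1 ≤ p.2}

/-- The total weight of the fibre of `q` over `d`. -/
noncomputable def fiberWeight {P A : Type*} [Fintype P] [DecidableEq A] (q : P → A) (h : P → ℝ)
    (d : A) : ℝ :=
  ∑ e : P, if q e = d then h e else 0

theorem fiberWeight_nonneg {P A : Type*} [Fintype P] [DecidableEq A] (q : P → A) {h : P → ℝ}
    (hh : ∀ e, 0 ≤ h e) (d : A) : 0 ≤ fiberWeight q h d :=
  Finset.sum_nonneg fun e _ => by split_ifs <;> simp [hh]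

theorem eq_zero_of_fiberWeight_eq_zero {P A : Type*} [Fintype P] [DecidableEq A] (q : P → A)
    {h : P → ℝ} (hh : ∀ e, 0 ≤ h e) (e : P) (h0 : fiberWeight q h (q e) = 0) : h e = 0 := by
  have h1 := (Finset.sum_eq_zero_iff_of_nonneg
    (fun e' _ => by split_ifs <;> simp [hh])).1 h0 e (Finset.mem_univ e)
  simpa using h1

/-- Normalizing the weights on each fibre yields a family of probability weights on the fibres. -/
theorem sum_div_fiberWeight_mul {P A : Type*} [Fintype P] [Fintype A] [DecidableEq A]
    (q : P → A) (h : P → ℝ) (φ : A → ℝ) (hφ : ∀ d, fiberWeight q h d = 0 → φ d = 0) :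
    ∑ g : P, h g / fiberWeight q h (q g) * φ (q g) = ∑ d : A, φ d := by
  rw [← Finset.sum_fiberwise Finset.univ q]
  refine Finset.sum_congr rfl fun d _ => ?_
  have h1 : ∑ g ∈ Finset.univ.filter (fun g => q g = d),
      h g / fiberWeight q h (q g) * φ (q g) = fiberWeight q h d / fiberWeight q h d * φ d := by
    conv_rhs => rw [fiberWeight.eq_def q h d, ← Finset.sum_filter, Finset.sum_div, Finset.sum_mul]
    refine Finset.sum_congr rfl fun g hg => ?_
    rw [(Finset.mem_filter.1 hg).2, fiberWeight, Finset.sum_filter]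
  rw [h1]
  by_cases h0 : fiberWeight q h d = 0
  · simp [hφ d h0]
  · rw [div_self h0, one_mul]

/-- A flow `η` between the classes of `p` and `q`, whose marginals are the fibre weights of `h`,
lifts to a flow on pairs with both marginals equal to `h`. -/
theorem exists_lift_flow {P A : Type*} [Fintype P] [Fintype A] [DecidableEq A]
    (p q : P → A) (h : P → ℝ) (hh : ∀ e, 0 ≤ h e) (η : A × A → ℝ) (hη : ∀ x, 0 ≤ η x)
    (hrow : ∀ d, ∑ d', η (d, d') = fiberWeight p h d)
    (hcol : ∀ d', ∑ d, η (d, d') = fiberWeight q h d') :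
    ∃ χ : P × P → ℝ, (∀ x, 0 ≤ χ x) ∧ (∀ f, ∑ g, χ (f, g) = h f) ∧
      (∀ g, ∑ f, χ (f, g) = h g) ∧
      (∀ d d', ∑ f, ∑ g, (if p f = d ∧ q g = d' then χ (f, g) else 0) = η (d, d')) := by
  have hr0 : ∀ d d', fiberWeight p h d = 0 → η (d, d') = 0 := fun d d' h0 =>
    (Finset.sum_eq_zero_iff_of_nonneg (fun _ _ => hη _)).1 ((hrow d).trans h0) d'
      (Finset.mem_univ d')
  have hc0 : ∀ d d', fiberWeight q h d' = 0 → η (d, d') = 0 := fun d d' h0 =>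
    (Finset.sum_eq_zero_iff_of_nonneg (fun _ _ => hη _)).1 ((hcol d').trans h0) d
      (Finset.mem_univ d)
  refine ⟨fun x => h x.1 / fiberWeight p h (p x.1) *
    (h x.2 / fiberWeight q h (q x.2) * η (p x.1, q x.2)), ?_, ?_, ?_, ?_⟩
  · exact fun x => mul_nonneg (div_nonneg (hh _) (fiberWeight_nonneg p hh _))
      (mul_nonneg (div_nonneg (hh _) (fiberWeight_nonneg q hh _)) (hη _))
  · intro f
    dsimp only
    rw [← Finset.mul_sum, sum_div_fiberWeight_mul q h (fun d' => η (p f, d')) (hc0 (p f)), hrow]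
    exact div_mul_cancel_of_imp (eq_zero_of_fiberWeight_eq_zero p hh f)
  · intro g
    simp only [mul_left_comm _ (h g / fiberWeight q h (q g))]
    rw [← Finset.mul_sum, sum_div_fiberWeight_mul p h (fun d => η (d, q g))
      (fun d => hr0 d (q g)), hcol]
    exact div_mul_cancel_of_imp (eq_zero_of_fiberWeight_eq_zero q hh g)
  · intro d d'
    have inner : ∀ f, ∑ g, (if p f = d ∧ q g = d' then h f / fiberWeight p h (p f) *
        (h g / fiberWeight q h (q g) * η (p f, q g)) else 0)
        = h f / fiberWeight p h (p f) * (if p f = d then η (p f, d') else 0) := by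
      intro f
      have := sum_div_fiberWeight_mul q h
        (fun x => if p f = d ∧ x = d' then η (p f, x) else 0)
        (fun x hx => by simp [hc0 _ x hx])
      have e : ∑ x, (if p f = d ∧ x = d' then η (p f, x) else 0)
          = if p f = d then η (p f, d') else 0 := by
        by_cases hd : p f = d <;> simp [hd]
      rw [← e, ← this, Finset.mul_sum]
      simp only [mul_ite, mul_zero]
    simp only [inner]
    rw [sum_div_fiberWeight_mul p h (fun x => if x = d then η (x, d') else 0)
      (fun x hx => by simp [hr0 x d' hx])]
    simp

/-- The push-forward of a flow on pairs to the classes of `p` and `q`: row sums. -/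
theorem sum_sum_sum_ite_and {P Q A B : Type*} [Fintype P] [Fintype Q] [Fintype B]
    [DecidableEq A] [DecidableEq B] (p : P → A) (q : Q → B) (χ : P → Q → ℝ) (d : A) :
    ∑ d', ∑ f, ∑ g, (if p f = d ∧ q g = d' then χ f g else 0)
      = ∑ f, if p f = d then ∑ g, χ f g else 0 := by
  rw [Finset.sum_comm]
  refine Finset.sum_congr rfl fun f _ => ?_
  rw [Finset.sum_comm]
  by_cases hd : p f = d <;> simp [hd]

/-- Lemma (lems2): the min-cost circulation LP on the bipartite graph `G` (with lower
capacity constraints on the arc sets `I_{d,d'}`) has the same value as the min-cost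
circulation LP on the auxiliary graph `G̃` with lower capacity constraints on the
individual arcs `((d,1),(d',2))`. In `G̃`, arcs in `Ã₁` run from `(d,1)` to `(d',2)`
and are indexed by `(d,d')`; arcs in `Ã₂` run from `(d',2)` to `(d,1)` for `d ≤ d'`
and are indexed by the pair `(d,d')` with `d ≤ d'`. -/
theorem stmt12 (D : ℕ) (hD : 2 ≤ D) (w : Fin D → Fin D → ℝ) :
    sInf {c : ℝ | ∃ (χ₁ : Patch D × Patch D → ℝ) (χ₂ : Patch D → ℝ),
        (∀ x, 0 ≤ χ₁ x) ∧ (∀ f, 0 ≤ χ₂ f) ∧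
        (∀ f : Patch D, ∑ g : Patch D, χ₁ (f, g) = χ₂ f) ∧
        (∀ g : Patch D, ∑ f : Patch D, χ₁ (f, g) = χ₂ g) ∧
        (∀ d d' : Fin D, w d d' ≤ ∑ f : Patch D, ∑ g : Patch D,
            if f.val.1 = d ∧ g.val.2 = d' then χ₁ (f, g) else 0) ∧
        c = ∑ f : Patch D, ∑ g : Patch D, χ₁ (f, g)}
      = sInf {c : ℝ | ∃ (η₁ : Fin D × Fin D → ℝ) (η₂ : Patch D → ℝ),
        (∀ x, 0 ≤ η₁ x) ∧ (∀ e, 0 ≤ η₂ e) ∧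
        (∀ d : Fin D, ∑ d' : Fin D, η₁ (d, d')
            = ∑ e : Patch D, if e.val.1 = d then η₂ e else 0) ∧
        (∀ d' : Fin D, ∑ d : Fin D, η₁ (d, d')
            = ∑ e : Patch D, if e.val.2 = d' then η₂ e else 0) ∧
        (∀ d d' : Fin D, w d d' ≤ η₁ (d, d')) ∧
        c = ∑ x : Fin D × Fin D, η₁ x} := by
  congr 1
  ext c
  constructor
  · rintro ⟨χ₁, χ₂, h1, h2, hout, hin, hw, rfl⟩
    refine ⟨fun x => ∑ f : Patch D, ∑ g : Patch D,
      if f.val.1 = x.1 ∧ g.val.2 = x.2 then χ₁ (f, g) else 0, χ₂, ?_, h2, ?_, ?_, hw, ?_⟩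
    · exact fun x => Finset.sum_nonneg fun f _ => Finset.sum_nonneg fun g _ => by
        split_ifs <;> simp [h1]
    · intro d
      simp only [← hout]
      exact sum_sum_sum_ite_and (fun f : Patch D => f.val.1) (fun g : Patch D => g.val.2)
        (fun f g => χ₁ (f, g)) d
    · intro d'
      simp only [← hin]
      rw [← sum_sum_sum_ite_and (fun g : Patch D => g.val.2) (fun f : Patch D => f.val.1)
        (fun g f => χ₁ (f, g)) d']
      refine Finset.sum_congr rfl fun d _ => ?_
      rw [Finset.sum_comm]
      simp only [and_comm]
    · rw [Fintype.sum_prod_type]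
      refine Eq.trans ?_ (Finset.sum_congr rfl fun d _ =>
        (sum_sum_sum_ite_and (fun f : Patch D => f.val.1) (fun g : Patch D => g.val.2)
          (fun f g => χ₁ (f, g)) d).symm)
      rw [eq_comm, Finset.sum_comm]
      simp
  · rintro ⟨η₁, η₂, h1, h2, hout, hin, hw, rfl⟩
    obtain ⟨χ, hχ, hrow, hcol, hI⟩ := exists_lift_flow (fun f : Patch D => f.val.1)
      (fun g : Patch D => g.val.2) η₂ h2 η₁ h1 hout hin
    refine ⟨χ, η₂, hχ, h2, hrow, hcol, fun d d' => (hw d d').trans_eq (hI d d').symm, ?_⟩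
    rw [Fintype.sum_prod_type]
    simp only [hout, hrow]
    rw [Finset.sum_comm]
    simp
end

section
/- Fix D ≥ 2 and real numbers v_{d,t} for d ∈ {1,…,D}, t ∈ {1,2}. For t ∈ {1,2} and d ∈ {1,…,D} let ε_{d,t} = {ζ ∈ ℝ^D : v_{d,t} + ζ_d > v_{e,t} + ζ_e for all e ≠ d}. Then: (i) for all d ≠ d', ε_{d,1} ∩ ε_{d',2} ≠ ∅ if and only if v_{d,2} − v_{d,1} < v_{d',2} − v_{d',1}; and (ii) for every d ∈ {1,…,D}, ε_{d,1} ∩ ε_{d,2} ≠ ∅. -/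
/-- Remark 3: the explicit `T = 2` patch characterization. For `d ≠ d'`, the pair
`(d,d')` is a patch (i.e. `ε_{d,1} ∩ ε_{d',2} ≠ ∅`) iff `Δv_d < Δv_{d'}`, and `(d,d)`
is always a patch. -/
theorem stmt15 (D : ℕ) (hD : 2 ≤ D) (v1 v2 : Fin D → ℝ)
    (e1 e2 : Fin D → Set (Fin D → ℝ))
    (he1 : ∀ d, e1 d = {ζ | ∀ e, e ≠ d → v1 e + ζ e < v1 d + ζ d})
    (he2 : ∀ d, e2 d = {ζ | ∀ e, e ≠ d → v2 e + ζ e < v2 d + ζ d}) :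
    (∀ d d' : Fin D, d ≠ d' →
      ((e1 d ∩ e2 d').Nonempty ↔ v2 d - v1 d < v2 d' - v1 d')) ∧
    (∀ d : Fin D, (e1 d ∩ e2 d).Nonempty) := by
  have hmin : ∀ d e : Fin D, v1 e + (min (v1 d - v1 e) (v2 d - v2 e) - 1) < v1 d ∧
      v2 e + (min (v1 d - v1 e) (v2 d - v2 e) - 1) < v2 d := fun d e =>
    ⟨by linarith [min_le_left (v1 d - v1 e) (v2 d - v2 e)],
      by linarith [min_le_right (v1 d - v1 e) (v2 d - v2 e)]⟩
  simp only [he1, he2]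
  refine ⟨fun d d' hne => ⟨?_, fun h => ?_⟩, fun d => ?_⟩
  · rintro ⟨ζ, h1, h2⟩
    linarith [h1 d' hne.symm, h2 d hne]
  · refine ⟨fun e => if e = d then 0 else
      if e = d' then ((v1 d - v1 d') + (v2 d - v2 d')) / 2
      else min (v1 d - v1 e) (v2 d - v2 e) - 1, fun e he => ?_, fun e he => ?_⟩
    · by_cases h' : e = d'
      · subst h'
        simp only [if_true, if_neg he]
        linarith
      · simp only [if_true, if_neg he, if_neg h']
        linarith [(hmin d e).1]
    · by_cases h' : e = d
      · subst h'
        simp only [if_true, if_neg hne.symm]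
        linarith
      · simp only [if_true, if_neg he, if_neg h', if_neg hne.symm]
        linarith [(hmin d e).2]
  · refine ⟨fun e => if e = d then 0 else min (v1 d - v1 e) (v2 d - v2 e) - 1,
      fun e he => ?_, fun e he => ?_⟩
    · simp only [if_true, if_neg he]
      linarith [(hmin d e).1]
    · simp only [if_true, if_neg he]
      linarith [(hmin d e).2]
end

section
/- Fix D ≥ 2, an initial condition y₀ ∈ {1,…,D}, real numbers v_{d,t} for d ∈ {1,…,D}, t ∈ {1,2}, and γ ∈ ℝ. On a probability space let ε₁, ε₂ be ℝ^D-valued random vectors with the same distribution, and assume that for all t ∈ {1,2}, all d ≠ d' and every c ∈ ℝ, P(ε_{t,d} − ε_{t,d'} = c) = 0. Define Y₁ as the almost surely unique d maximizing v_{d,1} + γ·1{d = y₀} + ε_{1,d} over d ∈ {1,…,D}, and Y₂ as the almost surely unique d maximizing v_{d,2} + γ·1{d = Y₁} + ε_{2,d}. For d, d₁ ∈ {1,…,D} set Δ(d, d₁) = v_{d,2} − v_{d,1} + γ·1{d = d₁} − γ·1{d = y₀}; for d₁ ∈ {1,…,D} let ℒ(d₁) = {A : ∅ ⊊ A ⊊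 {1,…,D}, Δ(d', d₁) ≤ Δ(d'', d₁) for all d' ∈ A and d'' ∉ A}, and let 𝒜 = ∪_{d} ℒ(d). Then for every A ∈ 𝒜, P( ∪_{d ∈ {1,…,D}} { Y₁ = d and Y₂ ∈ ∪{B : B ⊆ A, B ∈ ℒ(d)} } ) ≤ P(Y₁ ∈ A). -/
open MeasureTheory

/-- Theorem (thmPPD1): conditional moment inequalities for the two-period dynamic
multinomial choice model under conditional stationarity. `Y1` and `Y2` are the
(a.s. unique) utility-maximizing choices in periods 1 and 2, with state dependence
parameter `γ` and initial condition `y₀`; `Δ d d₁` is the deterministic utility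
improvement of alternative `d` when the period-2 state is `d₁`; `L d₁` is the family
of lower sets and `A` belongs to `𝒜 = ∪_d L d`. -/
theorem stmt16 (D : ℕ) (hD : 2 ≤ D) (y₀ : Fin D)
    (v1 v2 : Fin D → ℝ) (γ : ℝ)
    (Ω : Type*) [MeasurableSpace Ω] (P : Measure Ω) [IsProbabilityMeasure P]
    (ε1 ε2 : Ω → Fin D → ℝ) (hmeas1 : Measurable ε1) (hmeas2 : Measurable ε2)
    (hid : P.map ε1 = P.map ε2)
    (hatom1 : ∀ d d' : Fin D, d ≠ d' → ∀ c : ℝ, P {ω | ε1 ω d - ε1 ω d' = c} = 0)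
    (hatom2 : ∀ d d' : Fin D, d ≠ d' → ∀ c : ℝ, P {ω | ε2 ω d - ε2 ω d' = c} = 0)
    (Y1 Y2 : Ω → Fin D) (hY1m : Measurable Y1) (hY2m : Measurable Y2)
    (hY1 : ∀ᵐ ω ∂P, ∀ d : Fin D, d ≠ Y1 ω →
      v1 d + γ * (if d = y₀ then 1 else 0) + ε1 ω d
        < v1 (Y1 ω) + γ * (if Y1 ω = y₀ then 1 else 0) + ε1 ω (Y1 ω))
    (hY2 : ∀ᵐ ω ∂P, ∀ d : Fin D, d ≠ Y2 ω →
      v2 d + γ * (if d = Y1 ω then 1 else 0) + ε2 ω d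
        < v2 (Y2 ω) + γ * (if Y2 ω = Y1 ω then 1 else 0) + ε2 ω (Y2 ω))
    (Δ : Fin D → Fin D → ℝ)
    (hΔ : ∀ d d₁, Δ d d₁ = v2 d - v1 d + γ * (if d = d₁ then 1 else 0)
        - γ * (if d = y₀ then 1 else 0))
    (L : Fin D → Set (Set (Fin D)))
    (hL : ∀ d₁, L d₁ = {A | A.Nonempty ∧ A ≠ Set.univ ∧
      ∀ d' ∈ A, ∀ d'' ∉ A, Δ d' d₁ ≤ Δ d'' d₁})
    (A : Set (Fin D)) (hA : ∃ d, A ∈ L d) :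
    P {ω | ∃ d, Y1 ω = d ∧ Y2 ω ∈ ⋃₀ {B | B ⊆ A ∧ B ∈ L d}}
      ≤ P {ω | Y1 ω ∈ A} := by
  let u : Fin D → ℝ := fun d => v1 d + γ * (if d = y₀ then 1 else 0)
  let S : Set (Fin D → ℝ) := {e | ∃ k ∈ A, ∀ j ∉ A, u j + e j < u k + e k}
  have hS : MeasurableSet S := by
    have : S = ⋃ k ∈ A, ⋂ j ∈ Aᶜ, {e | u j + e j < u k + e k} := by
      ext e
      simp [S]
    rw [this]
    refine MeasurableSet.biUnion (Set.to_countable _) fun k _ =>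
      MeasurableSet.biInter (Set.to_countable _) fun j _ => ?_
    exact measurableSet_lt (by fun_prop) (by fun_prop)
  calc P {ω | ∃ d, Y1 ω = d ∧ Y2 ω ∈ ⋃₀ {B | B ⊆ A ∧ B ∈ L d}}
      ≤ P (ε2 ⁻¹' S) := by
        refine measure_mono_ae ?_
        filter_upwards [hY2] with ω h2
        rintro ⟨d, rfl, B, ⟨hBA, hB⟩, hYB⟩
        rw [hL] at hB
        refine ⟨Y2 ω, hBA hYB, fun j hj => ?_⟩
        have hjB : j ∉ B := fun h => hj (hBA h)
        have hΔle := hB.2.2 _ hYB j hjB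
        have hlt := h2 j fun h => hjB (h ▸ hYB)
        rw [hΔ, hΔ] at hΔle
        simp only [u]
        linarith
    _ = P (ε1 ⁻¹' S) := by
        rw [← Measure.map_apply hmeas2 hS, ← hid, Measure.map_apply hmeas1 hS]
    _ ≤ P {ω | Y1 ω ∈ A} := by
        refine measure_mono_ae ?_
        filter_upwards [hY1] with ω h1
        rintro ⟨k, hk, hlt⟩
        change Y1 ω ∈ A
        by_contra hY
        exact lt_asymm (hlt (Y1 ω) hY) (h1 k fun h => hY (h ▸ hk))
end

section
/- Fix T ≥ 2, real numbers v₁,…,v_T, γ₁, γ₂ ∈ ℝ, and y₀, y₋₁ ∈ {0,1}. On a probability space let ε₁,…,ε_T be real random variables all having the same marginal distribution and with P(ε_t = c) = 0 for every t and every c ∈ ℝ. Define Y₋₁ = y₋₁, Y₀ = y₀ and, recursively, Y_t = 1{v_t + γ₁ Y_{t−1} + γ₂ Y_{t−2} > ε_t} for t = 1,…,T. Set Δ_{1,2}(d₁) = (v₂ + γ₁ d₁ + γ₂ y₀) − (v₁ + γ₁ y₀ + γ₂ y₋₁); for 3 ≤ t ≤ T, Δ_{1,t}(d₁,d₂) =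 (v_t + γ₁ d₁ + γ₂ d₂) − (v₁ + γ₁ y₀ + γ₂ y₋₁), Δ⁺_{2,t}(d₁,d₂) = (v_t + γ₁ d₁ + γ₂ d₂) − (v₂ + max{γ₁,0} + γ₂ y₀), Δ⁻_{2,t}(d₁,d₂) = (v_t + γ₁ d₁ + γ₂ d₂) − (v₂ + min{γ₁,0} + γ₂ y₀); and for 3 ≤ s < t ≤ T, Δ⁺_{s,t}(d₁,d₂) = (v_t + γ₁ d₁ + γ₂ d₂) − (v_s + max{γ₁,0} + max{γ₂,0}), Δ⁻_{s,t}(d₁,d₂) = (v_t + γ₁ d₁ + γ₂ d₂) − (v_s + min{γ₁,0} + min{γ₂,0}). Then: (1) P(∪{Y₁ = d₁, Y₂ = 0 : d₁ ∈ {0,1}, Δ_{1,2}(d₁) ≥ 0}) ≤ P(Y₁ = 0); (2) P(∪{Y₁ = d₁, Y₂ = 1 : d₁ ∈ {0,1}, Δ_{1,2}(d₁) ≤ 0}) ≤ P(Y₁ = 1); for every t with 3 ≤ t ≤ T: (3) P(∪{Y_{t−2} = d₂, Y_{t−1} = d₁, Y_t = 0 : d₁,d₂ ∈ {0,1}, Δ_{1,t}(d₁,d₂)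 ≥ 0}) ≤ P(Y₁ = 0); (4) P(∪{Y_{t−2} = d₂, Y_{t−1} = d₁, Y_t = 1 : Δ_{1,t}(d₁,d₂) ≤ 0}) ≤ P(Y₁ = 1); (5) P(∪{Y_{t−2} = d₂, Y_{t−1} = d₁, Y_t = 0 : Δ⁺_{2,t}(d₁,d₂) ≥ 0}) ≤ P(Y₂ = 0); (6) P(∪{Y_{t−2} = d₂, Y_{t−1} = d₁, Y_t = 1 : Δ⁻_{2,t}(d₁,d₂) ≤ 0}) ≤ P(Y₂ = 1); and for all s, t with 3 ≤ s < t ≤ T: (7) P(∪{Y_{t−2} = d₂, Y_{t−1} = d₁, Y_t = 0 : Δ⁺_{s,t}(d₁,d₂) ≥ 0}) ≤ P(Y_s = 0); (8) P(∪{Y_{t−2} = d₂, Y_{t−1} = d₁, Y_t = 1 : Δ⁻_{s,t}(d₁,d₂) ≤ 0}) ≤ P(Y_s = 1). -/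
open MeasureTheory

/-- Comparing two events through a common measurable set of values of two random variables
with the same law. -/
theorem measure_le_of_map_eq {Ω α : Type*} [MeasurableSpace Ω] [MeasurableSpace α]
    {P : Measure Ω} {X Z : Ω → α} (hX : Measurable X) (hZ : Measurable Z)
    (h : P.map X = P.map Z) {S : Set α} (hS : MeasurableSet S) {A B : Set Ω}
    (hA : A ⊆ X ⁻¹' S) (hB : Z ⁻¹' S ⊆ B) : P A ≤ P B :=
  calc P A ≤ P (X ⁻¹' S) := measure_mono hA
    _ = P (Z ⁻¹' S) := by rw [← Measure.map_apply hX hS, h, Measure.map_apply hZ hS]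
    _ ≤ P B := measure_mono hB

theorem mul_le_max_zero_of_binary {d : ℝ} (hd : d = 0 ∨ d = 1) (γ : ℝ) : γ * d ≤ max γ 0 := by
  rcases hd with rfl | rfl <;> simp

theorem min_zero_le_mul_of_binary {d : ℝ} (hd : d = 0 ∨ d = 1) (γ : ℝ) : min γ 0 ≤ γ * d := by
  rcases hd with rfl | rfl <;> simp

/-- Proposition (propAR2P1): the conditional moment inequalities for the AR(2) dynamic
binary choice model `Y_t = 1{v_t + γ₁ Y_{t-1} + γ₂ Y_{t-2} > ε_t}`, `t = 1,…,T`, with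
initial condition `(Y₀, Y₋₁) = (y₀, ym1)` and conditionally stationary, atomless
shocks. -/
theorem stmt17 (T : ℕ) (hT : 2 ≤ T)
    (v : ℤ → ℝ) (γ₁ γ₂ y₀ ym1 : ℝ)
    (hy₀ : y₀ = 0 ∨ y₀ = 1) (hym1 : ym1 = 0 ∨ ym1 = 1)
    (Ω : Type*) [MeasurableSpace Ω] (P : Measure Ω) [IsProbabilityMeasure P]
    (ε : ℤ → Ω → ℝ)
    (hmeas : ∀ t : ℤ, 1 ≤ t → t ≤ (T : ℤ) → Measurable (ε t))
    (hid : ∀ s t : ℤ, 1 ≤ s → s ≤ (T : ℤ) → 1 ≤ t → t ≤ (T : ℤ) →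
      P.map (ε s) = P.map (ε t))
    (hatom : ∀ t : ℤ, 1 ≤ t → t ≤ (T : ℤ) → ∀ c : ℝ, P {ω | ε t ω = c} = 0)
    (Y : Ω → ℤ → ℝ)
    (hYm1 : ∀ ω, Y ω (-1) = ym1) (hY0 : ∀ ω, Y ω 0 = y₀)
    (hYrec : ∀ ω, ∀ t : ℤ, 1 ≤ t → t ≤ (T : ℤ) →
      Y ω t = if ε t ω < v t + γ₁ * Y ω (t - 1) + γ₂ * Y ω (t - 2) then 1 else 0) :
    (P {ω | ∃ d₁ : ℝ, (d₁ = 0 ∨ d₁ = 1) ∧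
        0 ≤ (v 2 + γ₁ * d₁ + γ₂ * y₀) - (v 1 + γ₁ * y₀ + γ₂ * ym1) ∧
        Y ω 1 = d₁ ∧ Y ω 2 = 0} ≤ P {ω | Y ω 1 = 0}) ∧
    (P {ω | ∃ d₁ : ℝ, (d₁ = 0 ∨ d₁ = 1) ∧
        (v 2 + γ₁ * d₁ + γ₂ * y₀) - (v 1 + γ₁ * y₀ + γ₂ * ym1) ≤ 0 ∧
        Y ω 1 = d₁ ∧ Y ω 2 = 1} ≤ P {ω | Y ω 1 = 1}) ∧
    (∀ t : ℤ, 3 ≤ t → t ≤ (T : ℤ) →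
      P {ω | ∃ d₁ d₂ : ℝ, (d₁ = 0 ∨ d₁ = 1) ∧ (d₂ = 0 ∨ d₂ = 1) ∧
          0 ≤ (v t + γ₁ * d₁ + γ₂ * d₂) - (v 1 + γ₁ * y₀ + γ₂ * ym1) ∧
          Y ω (t - 2) = d₂ ∧ Y ω (t - 1) = d₁ ∧ Y ω t = 0} ≤ P {ω | Y ω 1 = 0}) ∧
    (∀ t : ℤ, 3 ≤ t → t ≤ (T : ℤ) →
      P {ω | ∃ d₁ d₂ : ℝ, (d₁ = 0 ∨ d₁ = 1) ∧ (d₂ = 0 ∨ d₂ = 1) ∧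
          (v t + γ₁ * d₁ + γ₂ * d₂) - (v 1 + γ₁ * y₀ + γ₂ * ym1) ≤ 0 ∧
          Y ω (t - 2) = d₂ ∧ Y ω (t - 1) = d₁ ∧ Y ω t = 1} ≤ P {ω | Y ω 1 = 1}) ∧
    (∀ t : ℤ, 3 ≤ t → t ≤ (T : ℤ) →
      P {ω | ∃ d₁ d₂ : ℝ, (d₁ = 0 ∨ d₁ = 1) ∧ (d₂ = 0 ∨ d₂ = 1) ∧
          0 ≤ (v t + γ₁ * d₁ + γ₂ * d₂) - (v 2 + max γ₁ 0 + γ₂ * y₀) ∧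
          Y ω (t - 2) = d₂ ∧ Y ω (t - 1) = d₁ ∧ Y ω t = 0} ≤ P {ω | Y ω 2 = 0}) ∧
    (∀ t : ℤ, 3 ≤ t → t ≤ (T : ℤ) →
      P {ω | ∃ d₁ d₂ : ℝ, (d₁ = 0 ∨ d₁ = 1) ∧ (d₂ = 0 ∨ d₂ = 1) ∧
          (v t + γ₁ * d₁ + γ₂ * d₂) - (v 2 + min γ₁ 0 + γ₂ * y₀) ≤ 0 ∧
          Y ω (t - 2) = d₂ ∧ Y ω (t - 1) = d₁ ∧ Y ω t = 1} ≤ P {ω | Y ω 2 = 1}) ∧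
    (∀ s t : ℤ, 3 ≤ s → s < t → t ≤ (T : ℤ) →
      P {ω | ∃ d₁ d₂ : ℝ, (d₁ = 0 ∨ d₁ = 1) ∧ (d₂ = 0 ∨ d₂ = 1) ∧
          0 ≤ (v t + γ₁ * d₁ + γ₂ * d₂) - (v s + max γ₁ 0 + max γ₂ 0) ∧
          Y ω (t - 2) = d₂ ∧ Y ω (t - 1) = d₁ ∧ Y ω t = 0} ≤ P {ω | Y ω s = 0}) ∧
    (∀ s t : ℤ, 3 ≤ s → s < t → t ≤ (T : ℤ) →
      P {ω | ∃ d₁ d₂ : ℝ, (d₁ = 0 ∨ d₁ = 1) ∧ (d₂ = 0 ∨ d₂ = 1) ∧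
          (v t + γ₁ * d₁ + γ₂ * d₂) - (v s + min γ₁ 0 + min γ₂ 0) ≤ 0 ∧
          Y ω (t - 2) = d₂ ∧ Y ω (t - 1) = d₁ ∧ Y ω t = 1} ≤ P {ω | Y ω s = 1}) := by
  have binary : ∀ ω, ∀ t : ℤ, 1 ≤ t → t ≤ (T : ℤ) → Y ω t = 0 ∨ Y ω t = 1 := by
    intro ω t h1 h2
    rw [hYrec ω t h1 h2]
    split_ifs <;> simp
  have zero_le : ∀ s t : ℤ, 1 ≤ s → s ≤ (T : ℤ) → 1 ≤ t → t ≤ (T : ℤ) → ∀ (c : ℝ) (A : Set Ω),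
      (∀ ω, v s + γ₁ * Y ω (s - 1) + γ₂ * Y ω (s - 2) ≤ c) →
      (∀ ω ∈ A, c ≤ v t + γ₁ * Y ω (t - 1) + γ₂ * Y ω (t - 2) ∧ Y ω t = 0) →
      P A ≤ P {ω | Y ω s = 0} := by
    intro s t hs hsT ht htT c A hc hA
    refine measure_le_of_map_eq (hmeas t ht htT) (hmeas s hs hsT) (hid t s ht htT hs hsT)
      (measurableSet_Ici (a := c)) (fun ω hω => ?_) (fun ω hω => ?_)
    · obtain ⟨h1, h2⟩ := hA ω hω
      rw [hYrec ω t ht htT] at h2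
      exact h1.trans (not_lt.mp fun h => by simp [h] at h2)
    · have h : c ≤ ε s ω := hω
      rw [Set.mem_ofPred_eq, hYrec ω s hs hsT, if_neg (not_lt.mpr ((hc ω).trans h))]
  have one_le : ∀ s t : ℤ, 1 ≤ s → s ≤ (T : ℤ) → 1 ≤ t → t ≤ (T : ℤ) → ∀ (c : ℝ) (A : Set Ω),
      (∀ ω, c ≤ v s + γ₁ * Y ω (s - 1) + γ₂ * Y ω (s - 2)) →
      (∀ ω ∈ A, v t + γ₁ * Y ω (t - 1) + γ₂ * Y ω (t - 2) ≤ c ∧ Y ω t = 1) →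
      P A ≤ P {ω | Y ω s = 1} := by
    intro s t hs hsT ht htT c A hc hA
    refine measure_le_of_map_eq (hmeas t ht htT) (hmeas s hs hsT) (hid t s ht htT hs hsT)
      (measurableSet_Iio (a := c)) (fun ω hω => ?_) (fun ω hω => ?_)
    · obtain ⟨h1, h2⟩ := hA ω hω
      rw [hYrec ω t ht htT] at h2
      exact lt_of_lt_of_le (not_le.mp fun h => by simp [not_lt.mpr h] at h2) h1
    · have h : ε s ω < c := hω
      rw [Set.mem_ofPred_eq, hYrec ω s hs hsT, if_pos (h.trans_le (hc ω))]
  have index_one : ∀ ω, v 1 + γ₁ * Y ω (1 - 1) + γ₂ * Y ω (1 - 2) = v 1 + γ₁ * y₀ + γ₂ * ym1 := by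
    intro ω
    norm_num [hYm1, hY0]
  have index_two : ∀ ω, v 2 + γ₁ * Y ω (2 - 1) + γ₂ * Y ω (2 - 2) =
      v 2 + γ₁ * Y ω 1 + γ₂ * y₀ := by
    intro ω
    norm_num [hY0]
  refine ⟨?_, ?_, fun t h3 htT => ?_, fun t h3 htT => ?_, fun t h3 htT => ?_, fun t h3 htT => ?_,
    fun s t h3 hst htT => ?_, fun s t h3 hst htT => ?_⟩
  · refine zero_le 1 2 (by omega) (by omega) (by omega) (by omega) _ _
      (fun ω => (index_one ω).le) ?_
    rintro ω ⟨d₁, -, h, rfl, h0⟩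
    exact ⟨(sub_nonneg.mp h).trans (index_two ω).ge, h0⟩
  · refine one_le 1 2 (by omega) (by omega) (by omega) (by omega) _ _
      (fun ω => (index_one ω).ge) ?_
    rintro ω ⟨d₁, -, h, rfl, h0⟩
    exact ⟨(index_two ω).le.trans (sub_nonpos.mp h), h0⟩
  · refine zero_le 1 t (by omega) (by omega) (by omega) htT _ _
      (fun ω => (index_one ω).le) ?_
    rintro ω ⟨d₁, d₂, -, -, h, rfl, rfl, h0⟩
    exact ⟨sub_nonneg.mp h, h0⟩
  · refine one_le 1 t (by omega) (by omega) (by omega) htT _ _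
      (fun ω => (index_one ω).ge) ?_
    rintro ω ⟨d₁, d₂, -, -, h, rfl, rfl, h0⟩
    exact ⟨sub_nonpos.mp h, h0⟩
  · refine zero_le 2 t (by omega) (by omega) (by omega) htT (v 2 + max γ₁ 0 + γ₂ * y₀) _
      (fun ω => by
        have := mul_le_max_zero_of_binary (binary ω 1 (by omega) (by omega)) γ₁
        linarith [index_two ω]) ?_
    rintro ω ⟨d₁, d₂, -, -, h, rfl, rfl, h0⟩
    exact ⟨sub_nonneg.mp h, h0⟩
  · refine one_le 2 t (by omega) (by omega) (by omega) htT (v 2 + min γ₁ 0 + γ₂ * y₀) _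
      (fun ω => by
        have := min_zero_le_mul_of_binary (binary ω 1 (by omega) (by omega)) γ₁
        linarith [index_two ω]) ?_
    rintro ω ⟨d₁, d₂, -, -, h, rfl, rfl, h0⟩
    exact ⟨sub_nonpos.mp h, h0⟩
  · refine zero_le s t (by omega) (by omega) (by omega) htT (v s + max γ₁ 0 + max γ₂ 0) _
      (fun ω => by
        have := mul_le_max_zero_of_binary (binary ω (s - 1) (by omega) (by omega)) γ₁
        have := mul_le_max_zero_of_binary (binary ω (s - 2) (by omega) (by omega)) γ₂
        linarith) ?_
    rintro ω ⟨d₁, d₂, -, -, h, rfl, rfl, h0⟩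
    exact ⟨sub_nonneg.mp h, h0⟩
  · refine one_le s t (by omega) (by omega) (by omega) htT (v s + min γ₁ 0 + min γ₂ 0) _
      (fun ω => by
        have := min_zero_le_mul_of_binary (binary ω (s - 1) (by omega) (by omega)) γ₁
        have := min_zero_le_mul_of_binary (binary ω (s - 2) (by omega) (by omega)) γ₂
        linarith) ?_
    rintro ω ⟨d₁, d₂, -, -, h, rfl, rfl, h0⟩
    exact ⟨sub_nonpos.mp h, h0⟩
end

section
/- Fix real numbers v₁, v₂, v₃, γ₁, γ₂ ∈ ℝ and y₀, y₋₁ ∈ {0,1}, and assume the ordering v₃ + γ₂ ≤ v₁ + γ₁ y₀ + γ₂ y₋₁ ≤ v₂ + γ₂ y₀ ≤ v₃ + γ₁ + γ₂ ≤ v₃ ≤ v₂ + γ₁ + γ₂ y₀ ≤ v₃ + γ₁. On a probability space let ε₁, ε₂, ε₃ be real random variables all having the same marginal distribution and with P(ε_t = c) = 0 for every t and every c ∈ ℝ. Define Y₋₁ = y₋₁, Y₀ = y₀ and, recursively, Y_t = 1{v_t + γ₁ Y_{t−1} + γ₂ Y_{t−2} > ε_t} for t = 1, 2, 3. Then P(Y₂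 = 1, Y₃ = 0) ≤ P(Y₁ = 0, Y₂ = 0, Y₃ = 1) + P(Y₁ = 1). -/
open MeasureTheory

/-- Proposition (propAR2P2): in the three-period AR(2) dynamic binary choice model with
conditionally stationary atomless shocks, under the stated ordering of the index
quantities, `P(Y₂ = 1, Y₃ = 0) ≤ P(Y₁ = 0, Y₂ = 0, Y₃ = 1) + P(Y₁ = 1)`. -/
theorem stmt18 (v1 v2 v3 γ₁ γ₂ y₀ ym1 : ℝ)
    (hy₀ : y₀ = 0 ∨ y₀ = 1) (hym1 : ym1 = 0 ∨ ym1 = 1)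
    (ho1 : v3 + γ₂ ≤ v1 + γ₁ * y₀ + γ₂ * ym1)
    (ho2 : v1 + γ₁ * y₀ + γ₂ * ym1 ≤ v2 + γ₂ * y₀)
    (ho3 : v2 + γ₂ * y₀ ≤ v3 + γ₁ + γ₂)
    (ho4 : v3 + γ₁ + γ₂ ≤ v3)
    (ho5 : v3 ≤ v2 + γ₁ + γ₂ * y₀)
    (ho6 : v2 + γ₁ + γ₂ * y₀ ≤ v3 + γ₁)
    (Ω : Type*) [MeasurableSpace Ω] (P : Measure Ω) [IsProbabilityMeasure P]
    (ε1 ε2 ε3 : Ω → ℝ)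
    (hm1 : Measurable ε1) (hm2 : Measurable ε2) (hm3 : Measurable ε3)
    (hid12 : P.map ε1 = P.map ε2) (hid13 : P.map ε1 = P.map ε3)
    (hatom1 : ∀ c : ℝ, P {ω | ε1 ω = c} = 0)
    (hatom2 : ∀ c : ℝ, P {ω | ε2 ω = c} = 0)
    (hatom3 : ∀ c : ℝ, P {ω | ε3 ω = c} = 0)
    (Y1 Y2 Y3 : Ω → ℝ)
    (hY1 : ∀ ω, Y1 ω = if ε1 ω < v1 + γ₁ * y₀ + γ₂ * ym1 then 1 else 0)
    (hY2 : ∀ ω, Y2 ω = if ε2 ω < v2 + γ₁ * Y1 ω + γ₂ * y₀ then 1 else 0)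
    (hY3 : ∀ ω, Y3 ω = if ε3 ω < v3 + γ₁ * Y2 ω + γ₂ * Y1 ω then 1 else 0) :
    P {ω | Y2 ω = 1 ∧ Y3 ω = 0}
      ≤ P {ω | Y1 ω = 0 ∧ Y2 ω = 0 ∧ Y3 ω = 1} + P {ω | Y1 ω = 1} := by
  have hswap : P ({ω | ε2 ω < v2 + γ₂ * y₀} \ {ω | ε3 ω < v2 + γ₂ * y₀})
      = P ({ω | ε3 ω < v2 + γ₂ * y₀} \ {ω | ε2 ω < v2 + γ₂ * y₀}) := by
    have h2 : MeasurableSet {ω | ε2 ω < v2 + γ₂ * y₀} := measurableSet_lt hm2 measurable_const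
    have h3 : MeasurableSet {ω | ε3 ω < v2 + γ₂ * y₀} := measurableSet_lt hm3 measurable_const
    refine measure_sdiff_symm h2.nullMeasurableSet h3.nullMeasurableSet ?_ (measure_ne_top _ _)
    have h := congrArg (· (Set.Iio (v2 + γ₂ * y₀))) (hid12.symm.trans hid13)
    rw [Measure.map_apply hm2 measurableSet_Iio, Measure.map_apply hm3 measurableSet_Iio] at h
    exact h
  have hY1_cases : ∀ ω, Y1 ω = 0 ∨ Y1 ω = 1 := fun ω => by rw [hY1]; split_ifs <;> simp
  have hleft : {ω | Y2 ω = 1 ∧ Y3 ω = 0} ⊆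
      ({ω | ε2 ω < v2 + γ₂ * y₀} \ {ω | ε3 ω < v2 + γ₂ * y₀}) ∪
        ({ω | Y1 ω = 1} \ {ω | ε3 ω < v2 + γ₂ * y₀}) := by
    rintro ω ⟨h2, h3⟩
    rw [hY3, h2] at h3
    rw [hY2] at h2
    simp only [Set.mem_union, Set.mem_sdiff, Set.mem_ofPred_eq, not_lt]
    rcases hY1_cases ω with h1 | h1 <;> rw [h1] at h2 h3 <;> split_ifs at h2 h3 <;>
      first
        | (exfalso; linarith)
        | exact Or.inl ⟨by linarith, by linarith⟩
        | exact Or.inr ⟨h1, by linarith⟩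
  have hright : {ω | ε3 ω < v2 + γ₂ * y₀} \ {ω | ε2 ω < v2 + γ₂ * y₀} ⊆
      {ω | Y1 ω = 0 ∧ Y2 ω = 0 ∧ Y3 ω = 1} ∪
        ({ω | Y1 ω = 1} ∩ {ω | ε3 ω < v2 + γ₂ * y₀}) := by
    rintro ω ⟨h3, h2⟩
    simp only [Set.mem_ofPred_eq, not_lt] at h2 h3
    rcases hY1_cases ω with h1 | h1
    · have hY2_zero : Y2 ω = 0 := by
        rw [hY2, h1, if_neg (by linarith)]
      refine Or.inl ⟨h1, hY2_zero, ?_⟩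
      rw [hY3, h1, hY2_zero, if_pos (by linarith)]
    · exact Or.inr ⟨h1, h3⟩
  calc P {ω | Y2 ω = 1 ∧ Y3 ω = 0}
      ≤ P ({ω | ε3 ω < v2 + γ₂ * y₀} \ {ω | ε2 ω < v2 + γ₂ * y₀}) +
          P ({ω | Y1 ω = 1} \ {ω | ε3 ω < v2 + γ₂ * y₀}) := by
        rw [← hswap]
        exact (measure_mono hleft).trans (measure_union_le _ _)
    _ ≤ P {ω | Y1 ω = 0 ∧ Y2 ω = 0 ∧ Y3 ω = 1} +
          P ({ω | Y1 ω = 1} ∩ {ω | ε3 ω < v2 + γ₂ * y₀}) +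
          P ({ω | Y1 ω = 1} \ {ω | ε3 ω < v2 + γ₂ * y₀}) := by
        gcongr
        exact (measure_mono hright).trans (measure_union_le _ _)
    _ = P {ω | Y1 ω = 0 ∧ Y2 ω = 0 ∧ Y3 ω = 1} + P {ω | Y1 ω = 1} := by
        rw [add_assoc, measure_inter_add_sdiff _ (measurableSet_lt hm3 measurable_const)]
end
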